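/- arXiv:2407.15521 — 2 statements merged into one kernel-verified Lean document; each statement's English description precedes it below -/
import Mathlib

section
/- Assume (H). Then for every Schwartz function g : ℝ^d → ℂ one has sup_{ξ∈ℝ^d} ∫_{ℝ^d} |V_g F_μ(x,ξ)| dx < ∞. (That is, the generalized Fresnel function F_μ(y) = e^{2πiμ(y)} belongs to the modulation space M^{1,∞}(ℝ^d); equivalently, E_μ = F^{-1}F_μ belongs to the Wiener amalgam space W^{1,∞}(ℝ^d).) -/
open MeasureTheory Real Complex
open scoped ENNReal RealInnerProductSpace

noncomputable section

namespace Fresnel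

theorem fderiv_hom {E F : Type} [NormedAddCommGroup E] [NormedSpace ℝ E]
    [NormedAddCommGroup F] [NormedSpace ℝ F] (f : E → F) (s : ℝ)
    (hs : ContDiffOn ℝ (⊤ : ℕ∞) f {x | x ≠ 0})
    (hh : ∀ c : ℝ, 0 < c → ∀ x : E, x ≠ 0 → f (c • x) = c ^ s • f x) :
    ∀ c : ℝ, 0 < c → ∀ x : E, x ≠ 0 → fderiv ℝ f (c • x) = c ^ (s - 1) • fderiv ℝ f x := by
  intro c hc x hx
  have hopen : IsOpen {x : E | x ≠ 0} := isOpen_ne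
  have hd : ∀ y : E, y ≠ 0 → DifferentiableAt ℝ f y := fun y hy =>
    (hs.contDiffAt (hopen.mem_nhds hy)).differentiableAt (by simp)
  have h1 : HasFDerivAt (fun y => f (c • y))
      ((fderiv ℝ f (c • x)).comp (c • ContinuousLinearMap.id ℝ E)) x :=
    HasFDerivAt.comp x (hd (c • x) (smul_ne_zero hc.ne' hx)).hasFDerivAt
      ((hasFDerivAt_id x).const_smul c)
  have h2 : HasFDerivAt (fun y => c ^ s • f y) (c ^ s • fderiv ℝ f x) x :=
    (hd x hx).hasFDerivAt.const_smul _
  have h3 : (fun y => f (c • y)) =ᶠ[nhds x] (fun y => c ^ s • f y) := by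
    filter_upwards [hopen.mem_nhds hx] with y hy using hh c hc y hy
  have h4 := (h2.congr_of_eventuallyEq h3).unique h1
  ext v
  have h5 := congrArg (fun L : E →L[ℝ] F => L v) h4
  simp only [smul_apply, ContinuousLinearMap.comp_apply, ContinuousLinearMap.id_apply, map_smul] at h5 ⊢
  have : c ^ (s - 1) = c⁻¹ * c ^ s := by
    rw [Real.rpow_sub hc, Real.rpow_one]; field_simp
  rw [this, mul_smul, h5, smul_smul, inv_mul_cancel₀ hc.ne', one_smul]

theorem fderiv_smoothOn {E F : Type} [NormedAddCommGroup E] [NormedSpace ℝ E]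
    [NormedAddCommGroup F] [NormedSpace ℝ F] (f : E → F)
    (hs : ContDiffOn ℝ (⊤ : ℕ∞) f {x | x ≠ 0}) :
    ContDiffOn ℝ (⊤ : ℕ∞) (fderiv ℝ f) {x | x ≠ 0} :=
  hs.fderiv_of_isOpen isOpen_ne (by simp)

theorem iter_bound {E : Type} [NormedAddCommGroup E] [NormedSpace ℝ E] [FiniteDimensional ℝ E]
    (k : ℕ) : ∀ {F : Type} [NormedAddCommGroup F] [NormedSpace ℝ F] (f : E → F) (s : ℝ)
    (_ : ContDiffOn ℝ (⊤ : ℕ∞) f {x | x ≠ 0})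
    (_ : ∀ c : ℝ, 0 < c → ∀ x : E, x ≠ 0 → f (c • x) = c ^ s • f x),
    ∃ C : ℝ, ∀ x : E, x ≠ 0 → ‖iteratedFDeriv ℝ k f x‖ ≤ C * ‖x‖ ^ (s - k) := by
  induction k with
  | zero =>
    intro F _ _ f s hs hh
    have hK : IsCompact (Metric.sphere (0 : E) 1) := isCompact_sphere 0 1
    have hc : ContinuousOn f (Metric.sphere (0 : E) 1) :=
      hs.continuousOn.mono (fun x hx => by
        rintro rfl; simp at hx)
    obtain ⟨C, hC⟩ := hK.exists_bound_of_continuousOn hc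
    refine ⟨C, fun x hx => ?_⟩
    have hx' : 0 < ‖x‖ := norm_pos_iff.2 hx
    have h1 := hh ‖x‖ hx' (‖x‖⁻¹ • x) (smul_ne_zero (inv_ne_zero hx'.ne') hx)
    rw [smul_smul, mul_inv_cancel₀ hx'.ne', one_smul] at h1
    rw [norm_iteratedFDeriv_zero, h1, norm_smul, Real.norm_of_nonneg (by positivity), mul_comm]
    simp only [CharP.cast_eq_zero, sub_zero]
    refine mul_le_mul_of_nonneg_right (hC _ ?_) (by positivity)
    simp [norm_smul, hx'.ne']
  | succ k ih =>
    intro F _ _ f s hs hh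
    obtain ⟨C, hC⟩ := ih (fderiv ℝ f) (s - 1) (fderiv_smoothOn f hs) (fderiv_hom f s hs hh)
    refine ⟨C, fun x hx => ?_⟩
    rw [← norm_iteratedFDeriv_fderiv]
    convert hC x hx using 3
    push_cast; ring

/-- geometric lower bound -/
theorem lower_bound {E F : Type} [NormedAddCommGroup E] [NormedSpace ℝ E] [FiniteDimensional ℝ E]
    [NormedAddCommGroup F] [NormedSpace ℝ F] [CompleteSpace F] (f : E → F) (m : ℝ) (hm : 2 ≤ m)
    (hs : ContDiffOn ℝ (⊤ : ℕ∞) f {x | x ≠ 0})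
    (hh : ∀ c : ℝ, 0 < c → ∀ x : E, x ≠ 0 → f (c • x) = c ^ (m - 1) • f x)
    (hb : ∀ x : E, ‖x‖ = 1 → Function.Bijective ⇑(fderiv ℝ f x)) :
    ∃ c : ℝ, 0 < c ∧ ∃ T : Finset E, ∀ η : F, ∃ P : E → E, ∀ x : E, x ≠ 0 →
      c * ‖x‖ ^ (m - 2) * ‖x‖ ≤ ‖f x - η‖ ∨
      ∃ i ∈ T, c * ‖x‖ ^ (m - 2) * ‖x - P i‖ ≤ ‖f x - η‖ := by
  have hopen : IsOpen {x : E | x ≠ 0} := isOpen_ne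
  have hd : ∀ y : E, y ≠ 0 → DifferentiableAt ℝ f y := fun y hy =>
    (hs.contDiffAt (hopen.mem_nhds hy)).differentiableAt (by simp)
  have hhd := fderiv_hom f (m - 1) hs hh
  have normz : ∀ x : E, x ≠ 0 → ‖(‖x‖⁻¹ • x)‖ = 1 := fun x hx => by
    simp [norm_smul, norm_ne_zero_iff.2 hx]
  -- bijectivity everywhere
  have hbij : ∀ x : E, x ≠ 0 → Function.Bijective ⇑(fderiv ℝ f x) := by
    intro x hx
    have hx' : 0 < ‖x‖ := norm_pos_iff.2 hx
    have h1 := hhd ‖x‖⁻¹ (inv_pos.2 hx') x hx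
    have h2 := hb _ (normz x hx)
    rw [h1] at h2
    set a : ℝ := ‖x‖⁻¹ ^ (m - 1 - 1) with ha
    have ha0 : a ≠ 0 := by positivity
    constructor
    · intro u v huv
      apply h2.1
      simp only [smul_apply, huv]
    · intro w
      obtain ⟨v, hv⟩ := h2.2 (a • w)
      refine ⟨v, ?_⟩
      simp only [smul_apply] at hv
      exact smul_right_injective F ha0 hv
  -- nonvanishing
  have hne : ∀ x : E, ‖x‖ = 1 → f x ≠ 0 := by
    intro x hx h0
    have hx0 : x ≠ 0 := by rintro rfl; simp at hx
    have h1 : HasDerivAt (fun t : ℝ => f (t • x)) (fderiv ℝ f x x) 1 := by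
      have e1 : HasDerivAt (fun t : ℝ => t • x) x 1 := by
        simpa using (hasDerivAt_id (1 : ℝ)).smul_const x
      have e2 : HasFDerivAt f (fderiv ℝ f x) ((1 : ℝ) • x) := by
        rw [one_smul]; exact (hd x hx0).hasFDerivAt
      exact e2.comp_hasDerivAt (1 : ℝ) e1
    have h2 : HasDerivAt (fun t : ℝ => f (t • x)) 0 1 := by
      refine (hasDerivAt_const (1 : ℝ) (0 : F)).congr_of_eventuallyEq ?_
      filter_upwards [lt_mem_nhds (zero_lt_one (α := ℝ))] with t ht
      rw [hh t ht x hx0, h0, smul_zero]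
    have h3 := h1.unique h2
    exact hx0 ((hbij x hx0).1 (by rw [h3, map_zero]))
  -- lower and upper bounds
  have hK : IsCompact (Metric.sphere (0 : E) 1) := isCompact_sphere 0 1
  have hfc : ContinuousOn f (Metric.sphere (0 : E) 1) :=
    hs.continuousOn.mono (fun x hx => by rintro rfl; simp at hx)
  obtain ⟨C₀, hC₀⟩ := hK.exists_bound_of_continuousOn hfc
  obtain ⟨c₀, hc₀, hcl⟩ : ∃ c₀ : ℝ, 0 < c₀ ∧ ∀ x : E, ‖x‖ = 1 → c₀ ≤ ‖f x‖ := by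
    rcases (Metric.sphere (0 : E) 1).eq_empty_or_nonempty with he | hn
    · refine ⟨1, one_pos, fun x hx => ?_⟩
      have : x ∈ Metric.sphere (0 : E) 1 := by simpa using hx
      rw [he] at this; exact this.elim
    · obtain ⟨x0, hx0, hmin⟩ := hK.exists_isMinOn hn hfc.norm
      refine ⟨‖f x0‖, norm_pos_iff.2 (hne x0 (by simpa using hx0)), fun x hx => ?_⟩
      exact hmin (by simpa using hx)
  have hscale : ∀ x : E, x ≠ 0 → ‖f x‖ = ‖x‖ ^ (m - 1) * ‖f (‖x‖⁻¹ • x)‖ := by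
    intro x hx
    have hx' : 0 < ‖x‖ := norm_pos_iff.2 hx
    have h1 := hh ‖x‖ hx' (‖x‖⁻¹ • x) (smul_ne_zero (inv_ne_zero hx'.ne') hx)
    rw [smul_smul, mul_inv_cancel₀ hx'.ne', one_smul] at h1
    rw [h1, norm_smul, Real.norm_of_nonneg (by positivity)]
  set C₁ : ℝ := max C₀ 1 with hC₁
  have hC₁pos : 0 < C₁ := lt_max_of_lt_right one_pos
  have hup : ∀ x : E, x ≠ 0 → ‖f x‖ ≤ C₁ * ‖x‖ ^ (m - 1) := by
    intro x hx
    rw [hscale x hx, mul_comm]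
    exact mul_le_mul_of_nonneg_right ((hC₀ _ (by simpa using normz x hx)).trans (le_max_left _ _))
      (by positivity)
  have hlo : ∀ x : E, x ≠ 0 → c₀ * ‖x‖ ^ (m - 1) ≤ ‖f x‖ := by
    intro x hx
    rw [hscale x hx, mul_comm]
    exact mul_le_mul_of_nonneg_left (hcl _ (normz x hx)) (by positivity)
  -- annulus
  have hm1 : 0 < m - 1 := by linarith
  set a : ℝ := (1 / (2 * C₁)) ^ (1 / (m - 1)) with ha
  set b : ℝ := (2 / c₀) ^ (1 / (m - 1)) with hbdef
  have hapos : 0 < a := by positivity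
  have hbpos : 0 < b := by positivity
  have ham : a ^ (m - 1) = 1 / (2 * C₁) := by
    rw [ha, ← Real.rpow_mul (by positivity), one_div_mul_cancel hm1.ne', Real.rpow_one]
  have hbm : b ^ (m - 1) = 2 / c₀ := by
    rw [hbdef, ← Real.rpow_mul (by positivity), one_div_mul_cancel hm1.ne', Real.rpow_one]
  set A : Set E := {x | a ≤ ‖x‖ ∧ ‖x‖ ≤ b} with hA
  have hAc : IsCompact A := by
    refine Metric.isCompact_of_isClosed_isBounded ?_ ?_
    · exact (isClosed_le continuous_const continuous_norm).inter
        (isClosed_le continuous_norm continuous_const)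
    · refine (Metric.isBounded_closedBall (x := (0 : E)) (r := b)).subset (fun x hx => ?_)
      simpa using hx.2
  have hA0 : ∀ x ∈ A, x ≠ 0 := by
    rintro x hx rfl
    have := hx.1
    simp at this; linarith
  -- local antilipschitz
  have hloc : ∀ x ∈ A, ∃ r : ℝ, 0 < r ∧ ∃ κ : ℝ, 0 < κ ∧ Metric.closedBall x r ⊆ {x | x ≠ 0} ∧
      ∀ y ∈ Metric.closedBall x r, ∀ z ∈ Metric.closedBall x r, κ * ‖y - z‖ ≤ ‖f y - f z‖ := by
    intro x hx
    have hx0 := hA0 x hx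
    have hst : HasStrictFDerivAt f (fderiv ℝ f x) x :=
      (hs.contDiffAt (hopen.mem_nhds hx0)).hasStrictFDerivAt (by simp)
    let L : E ≃L[ℝ] F := ContinuousLinearEquiv.ofBijective (fderiv ℝ f x)
      (LinearMap.ker_eq_bot.2 (hbij x hx0).1) (LinearMap.range_eq_top.2 (hbij x hx0).2)
    have hL : (L : E →L[ℝ] F) = fderiv ℝ f x := ContinuousLinearEquiv.coe_ofBijective _ _ _
    have : Nontrivial E := ⟨x, 0, hx0⟩
    have hNpos : 0 < ‖(L.symm : F →L[ℝ] E)‖₊ := L.nnnorm_symm_pos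
    set c : NNReal := ‖(L.symm : F →L[ℝ] E)‖₊⁻¹ / 2 with hc
    have hcpos : 0 < c := half_pos (inv_pos.2 hNpos)
    obtain ⟨s, hsn, happ⟩ := hst.approximates_deriv_on_nhds (c := c) (Or.inr hcpos)
    rw [← hL] at happ
    have hclt : c < ‖(L.symm : F →L[ℝ] E)‖₊⁻¹ := half_lt_self (inv_pos.2 hNpos)
    have hanti := happ.antilipschitz (Or.inr hclt)
    obtain ⟨r, hr, hrs⟩ := Metric.nhds_basis_closedBall.mem_iff.1
      (Filter.inter_mem hsn (hopen.mem_nhds hx0))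
    set K : NNReal := (‖(L.symm : F →L[ℝ] E)‖₊⁻¹ - c)⁻¹ with hKdef
    have hKpos : 0 < K := inv_pos.2 (tsub_pos_of_lt hclt)
    refine ⟨r, hr, (K : ℝ)⁻¹, inv_pos.2 (by exact_mod_cast hKpos), fun y hy => (hrs hy).2, ?_⟩
    intro y hy z hz
    have h1 := hanti.le_mul_dist ⟨y, (hrs hy).1⟩ ⟨z, (hrs hz).1⟩
    simp only [Subtype.dist_eq, Set.domRestrict_apply, dist_eq_norm] at h1
    rw [inv_mul_le_iff₀ (by exact_mod_cast hKpos)]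
    exact h1
  choose! r hr κ hκ hsub hκb using hloc
  obtain ⟨T, hTA, hTcov⟩ := hAc.elim_nhds_subcover (fun x => Metric.closedBall x (r x))
    (fun x hx => Metric.closedBall_mem_nhds x (hr x hx))
  -- uniform constant
  obtain ⟨κ₀, hκ₀, hκle⟩ : ∃ κ₀ : ℝ, 0 < κ₀ ∧ ∀ i ∈ T, κ₀ ≤ κ i := by
    rcases T.eq_empty_or_nonempty with he | hn
    · exact ⟨1, one_pos, by simp [he]⟩
    · obtain ⟨j, hj, hjm⟩ := T.exists_min_image κ hn
      exact ⟨κ j, hκ j (hTA j hj), hjm⟩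
  have hm2 : 0 ≤ m - 2 := by linarith
  have hpw : ∀ x : E, x ≠ 0 → ‖x‖ ^ (m - 2) * ‖x‖ = ‖x‖ ^ (m - 1) := by
    intro x hx
    have hx' : 0 < ‖x‖ := norm_pos_iff.2 hx
    rw [← Real.rpow_add_one hx'.ne']; congr 1; ring
  set c : ℝ := min (c₀ / 2) (min (C₁) (κ₀ / (2 * b ^ (m - 2)))) with hcdef
  have hcpos : 0 < c := by
    rw [hcdef]; positivity
  have hc1 : c ≤ c₀ / 2 := min_le_left _ _
  have hc2 : c ≤ C₁ := (min_le_right _ _).trans (min_le_left _ _)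
  have hc3 : c * b ^ (m - 2) ≤ κ₀ / 2 := by
    have : c ≤ κ₀ / (2 * b ^ (m - 2)) := (min_le_right _ _).trans (min_le_right _ _)
    calc c * b ^ (m - 2) ≤ κ₀ / (2 * b ^ (m - 2)) * b ^ (m - 2) := by gcongr
      _ = κ₀ / 2 := by field_simp
  -- unit case
  have hunit : ∀ η : F, ‖η‖ = 1 → ∃ P : E → E, ∀ x : E, x ≠ 0 →
      c * ‖x‖ ^ (m - 2) * ‖x‖ ≤ ‖f x - η‖ ∨
      ∃ i ∈ T, c * ‖x‖ ^ (m - 2) * ‖x - P i‖ ≤ ‖f x - η‖ := by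
    intro η hη
    have hP : ∀ i ∈ T, ∃ p ∈ Metric.closedBall i (r i), ∀ y ∈ Metric.closedBall i (r i),
        ‖f p - η‖ ≤ ‖f y - η‖ := by
      intro i hi
      have hcont : ContinuousOn (fun y => ‖f y - η‖) (Metric.closedBall i (r i)) :=
        ((hs.continuousOn.mono (hsub i (hTA i hi))).sub continuousOn_const).norm
      obtain ⟨p, hp, hmin⟩ := (isCompact_closedBall i (r i)).exists_isMinOn
        ⟨i, Metric.mem_closedBall_self (hr i (hTA i hi)).le⟩ hcont
      exact ⟨p, hp, fun y hy => hmin hy⟩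
    choose! P hPmem hPmin using hP
    refine ⟨P, fun x hx => ?_⟩
    have hx' : 0 < ‖x‖ := norm_pos_iff.2 hx
    rw [mul_assoc c, hpw x hx]
    by_cases hxa : ‖x‖ < a
    · left
      have h1 : ‖x‖ ^ (m - 1) ≤ 1 / (2 * C₁) := by
        rw [← ham]; exact Real.rpow_le_rpow hx'.le hxa.le hm1.le
      have h2 := hup x hx
      have h3 : C₁ * ‖x‖ ^ (m - 1) ≤ 1 / 2 := by
        calc C₁ * ‖x‖ ^ (m - 1) ≤ C₁ * (1 / (2 * C₁)) := by gcongr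
          _ = 1 / 2 := by field_simp
      have h4 : ‖η‖ - ‖f x‖ ≤ ‖f x - η‖ := by
        rw [norm_sub_rev]; exact norm_sub_norm_le _ _
      have h5 : c * ‖x‖ ^ (m - 1) ≤ C₁ * ‖x‖ ^ (m - 1) := by gcongr
      linarith
    by_cases hxb : b < ‖x‖
    · left
      have h1 : 2 / c₀ ≤ ‖x‖ ^ (m - 1) := by
        rw [← hbm]; exact Real.rpow_le_rpow hbpos.le hxb.le hm1.le
      have h2 := hlo x hx
      have h3 : 1 ≤ c₀ / 2 * ‖x‖ ^ (m - 1) := by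
        calc (1 : ℝ) = c₀ / 2 * (2 / c₀) := by field_simp
          _ ≤ _ := by gcongr
      have h4 : ‖f x‖ - ‖η‖ ≤ ‖f x - η‖ := norm_sub_norm_le _ _
      have h5 : c * ‖x‖ ^ (m - 1) ≤ c₀ / 2 * ‖x‖ ^ (m - 1) := by gcongr
      linarith
    · right
      push Not at hxa hxb
      have hxA : x ∈ A := ⟨hxa, hxb⟩
      have := hTcov hxA
      simp only [Set.mem_iUnion] at this
      obtain ⟨i, hi, hxi⟩ := this
      refine ⟨i, hi, ?_⟩
      have h1 := hκb i (hTA i hi) x hxi (P i) (hPmem i hi)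
      have h2 := hPmin i hi x hxi
      have h3 : ‖f x - f (P i)‖ ≤ ‖f x - η‖ + ‖f (P i) - η‖ := by
        calc ‖f x - f (P i)‖ = ‖(f x - η) - (f (P i) - η)‖ := by congr 1; abel
          _ ≤ _ := norm_sub_le _ _
      have h4 : c * ‖x‖ ^ (m - 2) ≤ κ₀ / 2 :=
        le_trans (mul_le_mul_of_nonneg_left (Real.rpow_le_rpow hx'.le hxb hm2) hcpos.le) hc3
      have h5 : κ₀ * ‖x - P i‖ ≤ κ i * ‖x - P i‖ := by
        gcongr; exact hκle i hi
      have h6 : c * ‖x‖ ^ (m - 2) * ‖x - P i‖ ≤ κ₀ / 2 * ‖x - P i‖ := by gcongr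
      linarith
  refine ⟨c, hcpos, T, fun η => ?_⟩
  rcases eq_or_ne η 0 with rfl | hη
  · refine ⟨id, fun x hx => Or.inl ?_⟩
    rw [mul_assoc, hpw x hx, sub_zero]
    refine le_trans ?_ (hlo x hx)
    gcongr; linarith
  · have hη' : 0 < ‖η‖ := norm_pos_iff.2 hη
    obtain ⟨P, hP⟩ := hunit (‖η‖⁻¹ • η) (by simp [norm_smul, hη'.ne'])
    set l : ℝ := ‖η‖ ^ (1 / (m - 1)) with hl
    have hlpos : 0 < l := by positivity
    have hlm : l ^ (m - 1) = ‖η‖ := by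
      rw [hl, ← Real.rpow_mul (by positivity), one_div_mul_cancel hm1.ne', Real.rpow_one]
    refine ⟨fun i => l • P i, fun x hx => ?_⟩
    have hy : l⁻¹ • x ≠ 0 := smul_ne_zero (inv_ne_zero hlpos.ne') hx
    have hfx : f x = ‖η‖ • f (l⁻¹ • x) := by
      rw [← hlm, ← hh l hlpos _ hy, smul_smul, mul_inv_cancel₀ hlpos.ne', one_smul]
    have hdiff : ‖f x - η‖ = l ^ (m - 1) * ‖f (l⁻¹ • x) - ‖η‖⁻¹ • η‖ := by
      have : f x - η = ‖η‖ • (f (l⁻¹ • x) - ‖η‖⁻¹ • η) := by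
        rw [smul_sub, smul_smul, mul_inv_cancel₀ hη'.ne', one_smul, hfx]
      rw [this, norm_smul, norm_norm, hlm]
    have hnx : ‖l⁻¹ • x‖ = l⁻¹ * ‖x‖ := by
      rw [norm_smul, Real.norm_of_nonneg (inv_pos.2 hlpos).le]
    have hl1 : l ^ (m - 1) = l ^ (m - 2) * l := by
      rw [← Real.rpow_add_one hlpos.ne']; congr 1; ring
    have hl2 : (l⁻¹ * ‖x‖) ^ (m - 2) = (l ^ (m - 2))⁻¹ * ‖x‖ ^ (m - 2) := by
      rw [Real.mul_rpow (by positivity) (by positivity), Real.inv_rpow hlpos.le]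
    have hlp2 : 0 < l ^ (m - 2) := by positivity
    rcases hP _ hy with h | ⟨i, hi, h⟩
    · left
      rw [hdiff]
      refine le_trans (le_of_eq ?_) (mul_le_mul_of_nonneg_left h (by positivity))
      rw [hnx, hl2, hl1]; field_simp
    · right
      refine ⟨i, hi, ?_⟩
      rw [hdiff]
      refine le_trans (le_of_eq ?_) (mul_le_mul_of_nonneg_left h (by positivity))
      have h7 : ‖x - l • P i‖ = l * ‖l⁻¹ • x - P i‖ := by
        have : x - l • P i = l • (l⁻¹ • x - P i) := by
          rw [smul_sub, smul_smul, mul_inv_cancel₀ hlpos.ne', one_smul]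
        rw [this, norm_smul, Real.norm_of_nonneg hlpos.le]
      rw [h7, hnx, hl2, hl1]; field_simp


/-- uniformly Schwartz family -/
def US {ι E : Type} [NormedAddCommGroup E] [NormedSpace ℝ E] (h : ι → E → ℂ) : Prop :=
  (∀ i, ContDiff ℝ (⊤ : ℕ∞) (h i)) ∧
    ∀ k M : ℕ, ∃ C : ℝ, ∀ i u, (1 + ‖u‖) ^ M * ‖iteratedFDeriv ℝ k (h i) u‖ ≤ C

/-- family of uniformly temperate growth -/
def UT {ι E : Type} [NormedAddCommGroup E] [NormedSpace ℝ E] (a : ι → E → ℂ) : Prop :=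
  (∀ i, ContDiff ℝ (⊤ : ℕ∞) (a i)) ∧
    ∀ k : ℕ, ∃ M : ℕ, ∃ C : ℝ, 0 ≤ C ∧ ∀ i u, ‖iteratedFDeriv ℝ k (a i) u‖ ≤ C * (1 + ‖u‖) ^ M

theorem US.mul {ι E : Type} [NormedAddCommGroup E] [NormedSpace ℝ E] {a h : ι → E → ℂ}
    (hh : US h) (ha : UT a) : US (fun i u => a i u * h i u) := by
  refine ⟨fun i => (ha.1 i).mul (hh.1 i), fun k M => ?_⟩
  choose Ma Ca hCa hab using ha.2
  choose Ch hhb using hh.2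
  refine ⟨∑ j ∈ Finset.range (k + 1), (k.choose j : ℝ) * (Ca j * Ch (k - j) (M + Ma j)),
    fun i u => ?_⟩
  have h1 := norm_iteratedFDeriv_mul_le (ha.1 i) (hh.1 i) u (n := k)
    (by exact_mod_cast le_top)
  refine (mul_le_mul_of_nonneg_left h1 (by positivity)).trans ?_
  rw [Finset.mul_sum]
  refine Finset.sum_le_sum fun j _ => ?_
  have h2 := hab j i u
  have h3 := hhb (k - j) (M + Ma j) i u
  calc (1 + ‖u‖) ^ M * ((k.choose j : ℝ) * ‖iteratedFDeriv ℝ j (a i) u‖ *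
        ‖iteratedFDeriv ℝ (k - j) (h i) u‖)
      ≤ (1 + ‖u‖) ^ M * ((k.choose j : ℝ) * (Ca j * (1 + ‖u‖) ^ Ma j) *
        ‖iteratedFDeriv ℝ (k - j) (h i) u‖) := by gcongr
    _ = (k.choose j : ℝ) * (Ca j * ((1 + ‖u‖) ^ (M + Ma j) *
        ‖iteratedFDeriv ℝ (k - j) (h i) u‖)) := by rw [pow_add]; ring
    _ ≤ _ := by
      have := hCa j
      gcongr

theorem US.deriv {ι E : Type} [NormedAddCommGroup E] [NormedSpace ℝ E] {h : ι → E → ℂ}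
    (hh : US h) (e : ι → E) (he : ∀ i, ‖e i‖ ≤ 1) :
    US (fun i u => fderiv ℝ (h i) u (e i)) := by
  have hc : ∀ i, ContDiff ℝ (⊤ : ℕ∞) (fderiv ℝ (h i)) := fun i =>
    (hh.1 i).fderiv_right (by simp)
  refine ⟨fun i => (hc i).clm_apply contDiff_const, fun k M => ?_⟩
  obtain ⟨C, hC⟩ := hh.2 (k + 1) M
  refine ⟨C, fun i u => le_trans ?_ (hC i u)⟩
  gcongr
  refine (norm_iteratedFDeriv_clm_apply_const (hc i).contDiffAt
    (by exact_mod_cast le_top)).trans ?_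
  rw [norm_iteratedFDeriv_fderiv]
  exact mul_le_of_le_one_left (norm_nonneg _) (he i)

/-- oscillating factor -/
def osc {E : Type} [NormedAddCommGroup E] [InnerProductSpace ℝ E] (φ : E → ℝ) (ξ : E) (y : E) : ℂ :=
  Complex.exp (((2 * Real.pi * (φ y - ⟪ξ, y⟫) : ℝ) : ℂ) * Complex.I)

theorem norm_osc {E : Type} [NormedAddCommGroup E] [InnerProductSpace ℝ E] 
    (φ : E → ℝ) (ξ y : E) : ‖osc φ ξ y‖ = 1 := Complex.norm_exp_ofReal_mul_I _

theorem hasFDerivAt_osc {E : Type} [NormedAddCommGroup E] [InnerProductSpace ℝ E] 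
    {φ : E → ℝ} (hφ : ContDiff ℝ (⊤ : ℕ∞) φ) (ξ x u e : E) :
    DifferentiableAt ℝ (fun u => osc φ ξ (x + u)) u ∧
    fderiv ℝ (fun u => osc φ ξ (x + u)) u e =
      (2 * Real.pi * Complex.I) * ((fderiv ℝ φ (x + u) e - ⟪ξ, e⟫ : ℝ) : ℂ) * osc φ ξ (x + u) := by
  have h0 : HasFDerivAt (fun y => 2 * Real.pi * (φ y - ⟪ξ, y⟫))
      ((2 * Real.pi) • (fderiv ℝ φ (x + u) - innerSL ℝ ξ)) (x + u) := by
    have := (((hφ.differentiable (by simp)) (x + u)).hasFDerivAt.sub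
      (innerSL ℝ ξ).hasFDerivAt).const_smul (2 * Real.pi)
    exact this
  have h1 : HasFDerivAt (fun u => 2 * Real.pi * (φ (x + u) - ⟪ξ, x + u⟫))
      ((2 * Real.pi) • (fderiv ℝ φ (x + u) - innerSL ℝ ξ)) u := by
    have := h0.comp u ((hasFDerivAt_id u).const_add x)
    simpa [Function.comp_def] using this
  have h2 := ((Complex.ofRealCLM.hasFDerivAt.comp u h1).mul_const Complex.I).cexp
  have h3 : HasFDerivAt (fun u => osc φ ξ (x + u)) _ u := h2
  refine ⟨h3.differentiableAt, ?_⟩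
  rw [h3.fderiv]
  simp [osc]
  ring

section

variable {ι E : Type} [NormedAddCommGroup E] [InnerProductSpace ℝ E] [FiniteDimensional ℝ E]
  [MeasurableSpace E] [BorelSpace E]

theorem US.exists_integral_bound {h : ι → E → ℂ} (hh : US h) :
    (∀ i, Integrable (h i)) ∧ ∃ C : ℝ, ∀ i, ∫ u, ‖h i u‖ ≤ C := by
  obtain ⟨C, hC⟩ := hh.2 0 (Module.finrank ℝ E + 1)
  have hint : Integrable (fun u : E => C * (1 + ‖u‖) ^ (-((Module.finrank ℝ E + 1 : ℕ) : ℝ))) :=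
    (integrable_one_add_norm (by push_cast; linarith)).const_mul C
  have hle : ∀ i u, ‖h i u‖ ≤ C * (1 + ‖u‖) ^ (-((Module.finrank ℝ E + 1 : ℕ) : ℝ)) := by
    intro i u
    have h1 := hC i u
    rw [norm_iteratedFDeriv_zero] at h1
    have hp : 0 < 1 + ‖u‖ := by positivity
    rw [Real.rpow_neg hp.le, Real.rpow_natCast, ← div_eq_mul_inv, le_div_iff₀ (by positivity),
      mul_comm]
    exact h1
  have hI : ∀ i, Integrable (h i) := fun i =>
    hint.mono' (hh.1 i).continuous.aestronglyMeasurable (Filter.Eventually.of_forall (hle i))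
  exact ⟨hI, _, fun i => integral_mono (hI i).norm hint (hle i)⟩

theorem iterate_bound {φ : E → ℝ} (hφ : ContDiff ℝ (⊤ : ℕ∞) φ) (x e : ι → E) (Λ : ι → ℝ)
    (he : ∀ i, ‖e i‖ ≤ 1) (hΛ : ∀ i, 1 ≤ Λ i)
    (hUT : UT (fun i u => (((fderiv ℝ φ (x i + u) (e i) - fderiv ℝ φ (x i) (e i)) / Λ i : ℝ) : ℂ)))
    (N : ℕ) : ∀ h : ι → E → ℂ, US h → ∃ C : ℝ, ∀ i ξ,
      (|fderiv ℝ φ (x i) (e i) - ⟪ξ, e i⟫| / Λ i) ^ N *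
        ‖∫ u, osc φ ξ (x i + u) * h i u‖ ≤ C := by
  have hosc : ∀ i ξ, Continuous (fun u => osc φ ξ (x i + u)) := fun i ξ =>
    continuous_iff_continuousAt.2 fun u => (hasFDerivAt_osc hφ ξ (x i) u 0).1.continuousAt
  have hint : ∀ h : ι → E → ℂ, US h → ∀ i ξ, Integrable (fun u => osc φ ξ (x i + u) * h i u) := by
    intro h hh i ξ
    refine (hh.exists_integral_bound.1 i).norm.mono'
      ((hosc i ξ).mul (hh.1 i).continuous).aestronglyMeasurable
      (Filter.Eventually.of_forall fun u => ?_)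
    simp [norm_osc]
  induction N with
  | zero =>
    intro h hh
    obtain ⟨hI, C, hC⟩ := hh.exists_integral_bound
    refine ⟨C, fun i ξ => ?_⟩
    simp only [pow_zero, one_mul]
    refine (norm_integral_le_integral_norm _).trans (le_trans (le_of_eq ?_) (hC i))
    simp [norm_osc]
  | succ N ih =>
    intro h hh
    obtain ⟨C₁, hC₁⟩ := ih _ (hh.deriv e he)
    obtain ⟨C₂, hC₂⟩ := ih _ (hh.mul hUT)
    refine ⟨C₁ + C₂, fun i ξ => ?_⟩
    have h1 := hC₁ i ξ
    have h2 := hC₂ i ξ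
    set v : ℝ := fderiv ℝ φ (x i) (e i) - ⟪ξ, e i⟫ with hv
    have hL : 0 < Λ i := lt_of_lt_of_le one_pos (hΛ i)
    have i1 := hint _ hh i ξ
    have i2 := hint _ (hh.deriv e he) i ξ
    have i3 := hint _ (hh.mul hUT) i ξ
    have hkey : ∀ u, fderiv ℝ (fun u => osc φ ξ (x i + u)) u (e i) * h i u =
        (2 * Real.pi * Complex.I * (v : ℂ)) * (osc φ ξ (x i + u) * h i u) +
        (2 * Real.pi * Complex.I * (Λ i : ℂ)) * (osc φ ξ (x i + u) *
          ((((fderiv ℝ φ (x i + u) (e i) - fderiv ℝ φ (x i) (e i)) / Λ i : ℝ) : ℂ) * h i u)) := by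
      intro u
      rw [(hasFDerivAt_osc hφ ξ (x i) u (e i)).2, hv]
      have : (Λ i : ℂ) ≠ 0 := by exact_mod_cast hL.ne'
      push_cast
      field_simp
      ring
    have hibp := integral_mul_fderiv_eq_neg_fderiv_mul_of_integrable (μ := (volume : Measure E))
      (f := fun u => osc φ ξ (x i + u)) (g := h i) (v := e i)
      (by simp_rw [hkey]; exact (i1.const_mul _).add (i3.const_mul _)) i2 i1
      (fun u _ => (hasFDerivAt_osc hφ ξ (x i) u 0).1)
      (fun u _ => (hh.1 i).differentiable (by simp) u)
    simp_rw [hkey] at hibp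
    rw [integral_add (i1.const_mul _) (i3.const_mul _), integral_const_mul,
      integral_const_mul] at hibp
    set A := ∫ u, osc φ ξ (x i + u) * h i u with hA
    set B := ∫ u, osc φ ξ (x i + u) * fderiv ℝ (h i) u (e i) with hB
    set D := ∫ u, osc φ ξ (x i + u) *
          ((((fderiv ℝ φ (x i + u) (e i) - fderiv ℝ φ (x i) (e i)) / Λ i : ℝ) : ℂ) * h i u) with hD
    have h3 : (2 * Real.pi * Complex.I * (v : ℂ)) * A =
        -B - (2 * Real.pi * Complex.I * (Λ i : ℂ)) * D := by rw [hibp]; ring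
    have h4 : 2 * Real.pi * |v| * ‖A‖ ≤ ‖B‖ + 2 * Real.pi * Λ i * ‖D‖ := by
      have e1 := congrArg norm h3
      have e2 := norm_sub_le (-B) ((2 * Real.pi * Complex.I * (Λ i : ℂ)) * D)
      rw [← e1] at e2
      simpa [abs_of_pos Real.pi_pos, abs_of_pos hL] using e2
    have h5 : |v| / Λ i * ‖A‖ ≤ ‖B‖ + ‖D‖ := by
      rw [div_mul_eq_mul_div, div_le_iff₀ hL]
      have hpi : 1 ≤ 2 * Real.pi := by linarith [Real.pi_gt_three]
      have e1 : ‖B‖ ≤ 2 * Real.pi * (‖B‖ * Λ i) := by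
        have : ‖B‖ ≤ ‖B‖ * Λ i := le_mul_of_one_le_right (norm_nonneg _) (hΛ i)
        exact this.trans (le_mul_of_one_le_left (by positivity) hpi)
      have e2 : 2 * Real.pi * (|v| * ‖A‖) ≤ 2 * Real.pi * ((‖B‖ + ‖D‖) * Λ i) := by linarith
      exact le_of_mul_le_mul_left e2 (by positivity)
    calc (|v| / Λ i) ^ (N + 1) * ‖A‖ = (|v| / Λ i) ^ N * (|v| / Λ i * ‖A‖) := by ring
      _ ≤ (|v| / Λ i) ^ N * (‖B‖ + ‖D‖) := by gcongr
      _ = (|v| / Λ i) ^ N * ‖B‖ + (|v| / Λ i) ^ N * ‖D‖ := by ring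
      _ ≤ C₁ + C₂ := add_le_add h1 h2

end

theorem exists_mod {E : Type} [NormedAddCommGroup E] [InnerProductSpace ℝ E]
    [FiniteDimensional ℝ E] (μ : E → ℝ) (m : ℝ) (hm : 2 ≤ m)
    (hs : ContDiffOn ℝ (⊤ : ℕ∞) μ {x | x ≠ 0})
    (hh : ∀ c : ℝ, 0 < c → ∀ x : E, x ≠ 0 → μ (c • x) = c ^ m * μ x) :
    ∃ φ : E → ℝ, ContDiff ℝ (⊤ : ℕ∞) φ ∧ (∀ x, 1 ≤ ‖x‖ → φ x = μ x) ∧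
      (∀ x, 1 ≤ ‖x‖ → fderiv ℝ φ x = fderiv ℝ μ x) ∧
      ∀ k : ℕ, 2 ≤ k → ∃ C : ℝ, 0 ≤ C ∧ ∀ y,
        ‖iteratedFDeriv ℝ k φ y‖ ≤ C * (1 + ‖y‖) ^ (m - 2) := by
  let χ : ContDiffBump (0 : E) := ⟨1 / 4, 1 / 2, by norm_num, by norm_num⟩
  have hopen : IsOpen {x : E | x ≠ 0} := isOpen_ne
  let φ : E → ℝ := fun x => (1 - χ x) * μ x
  have hφ0 : ∀ x : E, ‖x‖ ≤ 1 / 4 → φ x = 0 := by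
    intro x hx
    have : χ x = 1 := χ.one_of_mem_closedBall (by
      rw [mem_closedBall_zero_iff]; exact hx)
    simp [φ, this]
  have hφ1 : ∀ x : E, 1 / 2 ≤ ‖x‖ → φ x = μ x := by
    intro x hx
    have : χ x = 0 := χ.zero_of_le_dist (by
      rw [dist_zero_right]; exact hx)
    simp [φ, this]
  have hev : ∀ x : E, 1 ≤ ‖x‖ → φ =ᶠ[nhds x] μ := by
    intro x hx
    filter_upwards [(isOpen_lt continuous_const continuous_norm).mem_nhds
      (show (1 / 2 : ℝ) < ‖x‖ by linarith)] with y hy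
    exact hφ1 y (le_of_lt hy)
  have hsm : ContDiff ℝ (⊤ : ℕ∞) φ := by
    rw [contDiff_iff_contDiffAt]
    intro x
    by_cases hx : x = 0
    · refine (contDiffAt_const (c := (0 : ℝ))).congr_of_eventuallyEq ?_
      filter_upwards [(isOpen_lt continuous_norm continuous_const).mem_nhds
        (show ‖x‖ < (1 / 4 : ℝ) by rw [hx]; norm_num)] with y hy
      exact hφ0 y (le_of_lt hy)
    · exact (contDiffAt_const.sub χ.contDiff.contDiffAt).mul (hs.contDiffAt (hopen.mem_nhds hx))
  refine ⟨φ, hsm, fun x hx => hφ1 x (by linarith), fun x hx => (hev x hx).fderiv_eq,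
    fun k hk => ?_⟩
  obtain ⟨C₁, hC₁⟩ := iter_bound k μ m hs hh
  obtain ⟨C₂, hC₂⟩ := (isCompact_closedBall (0 : E) 1).exists_bound_of_continuousOn
    (f := iteratedFDeriv ℝ k φ)
    (hsm.continuous_iteratedFDeriv (by exact_mod_cast le_top)).continuousOn
  have hm2 : 0 ≤ m - 2 := by linarith
  refine ⟨max (max C₁ C₂) 0, le_max_right _ _, fun y => ?_⟩
  by_cases hy : ‖y‖ ≤ 1
  · have h1 := hC₂ y (by simpa using hy)
    have h2 : 1 ≤ (1 + ‖y‖) ^ (m - 2) := Real.one_le_rpow (by linarith [norm_nonneg y]) hm2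
    calc _ ≤ C₂ := h1
      _ ≤ max (max C₁ C₂) 0 := (le_max_right _ _).trans (le_max_left _ _)
      _ ≤ _ := le_mul_of_one_le_right (le_max_right _ _) h2
  · push Not at hy
    have hy0 : y ≠ 0 := by rintro rfl; simp at hy; linarith
    have h1 := hC₁ y hy0
    rw [((hev y hy.le).iteratedFDeriv ℝ k).eq_of_nhds]
    have h2 : ‖y‖ ^ (m - k) ≤ (1 + ‖y‖) ^ (m - 2) := by
      have hk' : (2 : ℝ) ≤ k := by exact_mod_cast hk
      calc ‖y‖ ^ (m - k) ≤ ‖y‖ ^ (m - 2) := Real.rpow_le_rpow_of_exponent_le hy.le (by linarith)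
        _ ≤ _ := Real.rpow_le_rpow (norm_nonneg _) (by linarith) hm2
    calc _ ≤ C₁ * ‖y‖ ^ (m - k) := h1
      _ ≤ max (max C₁ C₂) 0 * ‖y‖ ^ (m - k) := by
        gcongr; exact (le_max_left _ _).trans (le_max_left _ _)
      _ ≤ _ := by gcongr

theorem ut_phase {E : Type} [NormedAddCommGroup E] [InnerProductSpace ℝ E]
    (φ : E → ℝ) (m : ℝ) (hm : 2 ≤ m)
    (hφ : ContDiff ℝ (⊤ : ℕ∞) φ)
    (hb : ∀ k : ℕ, 2 ≤ k → ∃ C : ℝ, 0 ≤ C ∧ ∀ y,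
        ‖iteratedFDeriv ℝ k φ y‖ ≤ C * (1 + ‖y‖) ^ (m - 2)) :
    UT (fun (i : {p : E × E // ‖p.2‖ ≤ 1}) (u : E) =>
      (((fderiv ℝ φ (i.1.1 + u) i.1.2 - fderiv ℝ φ i.1.1 i.1.2) /
        (1 + ‖i.1.1‖) ^ (m - 2) : ℝ) : ℂ)) := by
  have hm2 : 0 ≤ m - 2 := by linarith
  have hD : ContDiff ℝ (⊤ : ℕ∞) (fderiv ℝ φ) := hφ.fderiv_right (by simp)
  let L : {p : E × E // ‖p.2‖ ≤ 1} → (E →L[ℝ] ℝ) →L[ℝ] ℂ := fun i =>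
    Complex.ofRealCLM.comp (((1 + ‖i.1.1‖) ^ (m - 2))⁻¹ • ContinuousLinearMap.apply ℝ ℝ i.1.2)
  have hLa : ∀ i T, L i T = (((T i.1.2) / (1 + ‖i.1.1‖) ^ (m - 2) : ℝ) : ℂ) := by
    intro i T
    simp [L, div_eq_inv_mul]
  have hLn : ∀ i, ‖L i‖ ≤ ((1 + ‖i.1.1‖) ^ (m - 2))⁻¹ := by
    intro i
    refine ContinuousLinearMap.opNorm_le_bound _ (by positivity) fun T => ?_
    rw [hLa, Complex.norm_real, norm_div, Real.norm_of_nonneg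
      (show 0 ≤ (1 + ‖i.1.1‖) ^ (m - 2) by positivity), div_eq_inv_mul]
    gcongr
    exact (T.le_opNorm _).trans (mul_le_of_le_one_right (norm_nonneg _) i.2)
  have hfun : ∀ i : {p : E × E // ‖p.2‖ ≤ 1}, (fun u : E =>
      (((fderiv ℝ φ (i.1.1 + u) i.1.2 - fderiv ℝ φ i.1.1 i.1.2) /
        (1 + ‖i.1.1‖) ^ (m - 2) : ℝ) : ℂ)) =
      fun u => L i (fderiv ℝ φ (i.1.1 + u)) - L i (fderiv ℝ φ i.1.1) := by
    intro i
    funext u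
    rw [hLa, hLa]; push_cast; ring
  have hsh : ∀ x : E, ContDiff ℝ (⊤ : ℕ∞) (fun u => fderiv ℝ φ (x + u)) := fun x =>
    hD.comp (contDiff_const.add contDiff_id)
  have hpe : ∀ (x u : E), (1 + ‖x‖ + ‖u‖) ^ (m - 2) ≤
      (1 + ‖x‖) ^ (m - 2) * (1 + ‖u‖) ^ ⌈m - 2⌉₊ := by
    intro x u
    have h1 : (1 + ‖u‖) ^ (m - 2) ≤ (1 + ‖u‖) ^ ⌈m - 2⌉₊ := by
      rw [← Real.rpow_natCast]
      exact Real.rpow_le_rpow_of_exponent_le (by linarith [norm_nonneg u]) (Nat.le_ceil _)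
    calc (1 + ‖x‖ + ‖u‖) ^ (m - 2) ≤ ((1 + ‖x‖) * (1 + ‖u‖)) ^ (m - 2) := by
          apply Real.rpow_le_rpow (by positivity) _ hm2
          nlinarith [norm_nonneg x, norm_nonneg u, mul_nonneg (norm_nonneg x) (norm_nonneg u)]
      _ = (1 + ‖x‖) ^ (m - 2) * (1 + ‖u‖) ^ (m - 2) :=
          Real.mul_rpow (by positivity) (by positivity)
      _ ≤ _ := by gcongr
  refine ⟨fun i => ?_, fun k => ?_⟩
  · beta_reduce; rw [hfun i]
    exact ((L i).contDiff.comp (hsh _)).sub contDiff_const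
  · rcases k with _ | k
    · obtain ⟨C, hC0, hC⟩ := hb 2 le_rfl
      refine ⟨⌈m - 2⌉₊ + 1, C, hC0, fun i u => ?_⟩
      beta_reduce; rw [hfun i, norm_iteratedFDeriv_zero, ← map_sub]
      set x := i.1.1
      have h1 : ‖fderiv ℝ φ (x + u) - fderiv ℝ φ x‖ ≤
          C * (1 + ‖x‖ + ‖u‖) ^ (m - 2) * ‖(x + u) - x‖ := by
        refine (convex_closedBall x ‖u‖).norm_image_sub_le_of_norm_fderiv_le (𝕜 := ℝ)
          (fun y _ => hD.differentiable (by simp) y) (fun y hy => ?_)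
          (Metric.mem_closedBall_self (norm_nonneg _)) (by simp)
        rw [← norm_iteratedFDeriv_one, norm_iteratedFDeriv_fderiv]
        refine (hC y).trans ?_
        gcongr ?_ * ?_
        apply Real.rpow_le_rpow (by positivity) _ hm2
        have : ‖y - x‖ ≤ ‖u‖ := by simpa [dist_eq_norm] using hy
        have := norm_le_insert' y x
        linarith
      rw [add_sub_cancel_left] at h1
      have hp : 0 < (1 + ‖x‖) ^ (m - 2) := by positivity
      calc ‖L i (fderiv ℝ φ (x + u) - fderiv ℝ φ x)‖
          ≤ ‖L i‖ * ‖fderiv ℝ φ (x + u) - fderiv ℝ φ x‖ := (L i).le_opNorm _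
        _ ≤ ((1 + ‖x‖) ^ (m - 2))⁻¹ * (C * (1 + ‖x‖ + ‖u‖) ^ (m - 2) * ‖u‖) :=
            mul_le_mul (hLn i) h1 (norm_nonneg _) (by positivity)
        _ ≤ ((1 + ‖x‖) ^ (m - 2))⁻¹ *
            (C * ((1 + ‖x‖) ^ (m - 2) * (1 + ‖u‖) ^ ⌈m - 2⌉₊) * (1 + ‖u‖)) := by
            gcongr
            · exact hpe x u
            · linarith
        _ = C * (1 + ‖u‖) ^ (⌈m - 2⌉₊ + 1) := by rw [pow_succ]; field_simp
    · obtain ⟨C, hC0, hC⟩ := hb (k + 2) (by omega)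
      refine ⟨⌈m - 2⌉₊, C, hC0, fun i u => ?_⟩
      beta_reduce; rw [hfun i, ← norm_iteratedFDeriv_fderiv]
      set x := i.1.1
      have e1 : fderiv ℝ (fun u => L i (fderiv ℝ φ (x + u)) - L i (fderiv ℝ φ x)) =
          fderiv ℝ (fun u => L i (fderiv ℝ φ (x + u))) := by
        funext v
        exact fderiv_sub_const _
      rw [e1, norm_iteratedFDeriv_fderiv]
      have e2 : ‖iteratedFDeriv ℝ (k + 1) (fun u => L i (fderiv ℝ φ (x + u))) u‖ ≤
          ‖L i‖ * ‖iteratedFDeriv ℝ (k + 1) (fun u => fderiv ℝ φ (x + u)) u‖ :=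
        (L i).norm_iteratedFDeriv_comp_left (hsh x).contDiffAt (by exact_mod_cast le_top)
      rw [iteratedFDeriv_comp_add_left, norm_iteratedFDeriv_fderiv] at e2
      have hp : 0 < (1 + ‖x‖) ^ (m - 2) := by positivity
      have e3 : (1 + ‖x + u‖) ^ (m - 2) ≤ (1 + ‖x‖ + ‖u‖) ^ (m - 2) := by
        apply Real.rpow_le_rpow (by positivity) _ hm2
        linarith [norm_add_le x u]
      calc _ ≤ _ := e2
        _ ≤ ((1 + ‖x‖) ^ (m - 2))⁻¹ * (C * (1 + ‖x + u‖) ^ (m - 2)) :=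
            mul_le_mul (hLn i) (hC _) (norm_nonneg _) (by positivity)
        _ ≤ ((1 + ‖x‖) ^ (m - 2))⁻¹ * (C * ((1 + ‖x‖) ^ (m - 2) * (1 + ‖u‖) ^ ⌈m - 2⌉₊)) := by
            gcongr
            exact e3.trans (hpe x u)
        _ = C * (1 + ‖u‖) ^ ⌈m - 2⌉₊ := by field_simp

theorem us_window {ι E : Type} [NormedAddCommGroup E] [NormedSpace ℝ E] (g : SchwartzMap E ℂ) :
    US (fun (_ : ι) (u : E) => (starRingEnd ℂ) (g u)) := by
  have hc : ContDiff ℝ (⊤ : ℕ∞) (fun u : E => (starRingEnd ℂ) (g u)) :=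
    Complex.conjCLE.contDiff.comp (g.smooth ⊤)
  refine ⟨fun _ => hc, fun k M => ?_⟩
  have h := SchwartzMap.one_add_le_sup_seminorm_apply (𝕜 := ℝ) (m := (M, k)) (le_refl M) (le_refl k) g
  refine ⟨_, fun _ u => le_trans (le_of_eq ?_) (h u)⟩
  congr 1
  exact Complex.conjLIE.norm_iteratedFDeriv_comp_left (𝕜 := ℝ) g u k

theorem W_bound {E : Type} [NormedAddCommGroup E] [InnerProductSpace ℝ E]
    [FiniteDimensional ℝ E] [MeasurableSpace E] [BorelSpace E]
    (φ : E → ℝ) (m : ℝ) (hm : 2 ≤ m)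
    (hφ : ContDiff ℝ (⊤ : ℕ∞) φ)
    (hb : ∀ k : ℕ, 2 ≤ k → ∃ C : ℝ, 0 ≤ C ∧ ∀ y,
        ‖iteratedFDeriv ℝ k φ y‖ ≤ C * (1 + ‖y‖) ^ (m - 2))
    (g : SchwartzMap E ℂ) (N : ℕ) :
    ∃ C : ℝ, ∀ x ξ : E, (‖fderiv ℝ φ x - innerSL ℝ ξ‖ / (1 + ‖x‖) ^ (m - 2)) ^ N *
      ‖∫ y, osc φ ξ y * (starRingEnd ℂ) (g (y - x))‖ ≤ C := by
  obtain ⟨C, hC⟩ := iterate_bound (ι := {p : E × E // ‖p.2‖ ≤ 1}) hφ (fun i => i.1.1)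
    (fun i => i.1.2) (fun i => (1 + ‖i.1.1‖) ^ (m - 2)) (fun i => i.2)
    (fun i => Real.one_le_rpow (by linarith [norm_nonneg i.1.1]) (by linarith))
    (ut_phase φ m hm hφ hb) N _ (us_window g)
  refine ⟨C, fun x ξ => ?_⟩
  set p : E →L[ℝ] ℝ := fderiv ℝ φ x - innerSL ℝ ξ with hp
  set w : E := (InnerProductSpace.toDual ℝ E).symm p with hw
  have hwn : ‖w‖ = ‖p‖ := LinearIsometryEquiv.norm_map _ _
  have hpw : ∀ z, p z = ⟪w, z⟫ := fun z => (InnerProductSpace.toDual_symm_apply).symm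
  have he : ‖‖w‖⁻¹ • w‖ ≤ 1 := by
    rw [norm_smul, norm_inv, norm_norm]
    exact inv_mul_le_one
  have hpe : p (‖w‖⁻¹ • w) = ‖p‖ := by
    rw [hpw, inner_smul_right, real_inner_self_eq_norm_sq, hwn]
    rcases eq_or_ne ‖p‖ 0 with h | h
    · simp [h]
    · field_simp
  have h1 := hC ⟨(x, ‖w‖⁻¹ • w), he⟩ ξ
  simp only at h1
  have h2 : fderiv ℝ φ x (‖w‖⁻¹ • w) - ⟪ξ, ‖w‖⁻¹ • w⟫ = ‖p‖ := by
    rw [← hpe]; rfl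
  rw [h2, abs_of_nonneg (norm_nonneg p)] at h1
  have h3 : ∫ y, osc φ ξ y * (starRingEnd ℂ) (g (y - x)) =
      ∫ u, osc φ ξ (x + u) * (starRingEnd ℂ) (g u) := by
    rw [← integral_add_left_eq_self _ x]
    simp
  rw [h3]
  exact h1

theorem norm_split {E : Type} [MeasurableSpace E] (ν : Measure E) (A B : E → ℂ)
    (hB : Integrable B ν) :
    ‖∫ y, A y ∂ν‖ₑ ≤ ‖∫ y, B y ∂ν‖ₑ + ∫⁻ y, ‖A y - B y‖ₑ ∂ν := by
  by_cases hA : Integrable A ν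
  · have h1 : ∫ y, A y ∂ν = ∫ y, B y ∂ν + ∫ y, (A y - B y) ∂ν := by
      rw [integral_sub hA hB]; ring
    rw [h1]
    exact (enorm_add_le _ _).trans (add_le_add le_rfl (enorm_integral_le_lintegral_enorm _))
  · rw [integral_undef hA]; simp

theorem W_pointwise {E : Type} [NormedAddCommGroup E] [InnerProductSpace ℝ E]
    [FiniteDimensional ℝ E] [MeasurableSpace E] [BorelSpace E]
    (μ φ : E → ℝ) (m : ℝ) (hm : 2 ≤ m)
    (hs : ContDiffOn ℝ (⊤ : ℕ∞) μ {x | x ≠ 0})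
    (hh : ∀ c : ℝ, 0 < c → ∀ x : E, x ≠ 0 → μ (c • x) = c ^ m * μ x)
    (hhess : ∀ x : E, ‖x‖ = 1 → Function.Bijective ⇑(fderiv ℝ (fderiv ℝ μ) x))
    (hφ : ContDiff ℝ (⊤ : ℕ∞) φ)
    (hφd : ∀ x, 1 ≤ ‖x‖ → fderiv ℝ φ x = fderiv ℝ μ x)
    (hb : ∀ k : ℕ, 2 ≤ k → ∃ C : ℝ, 0 ≤ C ∧ ∀ y,
        ‖iteratedFDeriv ℝ k φ y‖ ≤ C * (1 + ‖y‖) ^ (m - 2))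
    (g : SchwartzMap E ℂ) (N : ℕ) :
    ∃ C : ℝ, 0 ≤ C ∧ ∃ T : Finset E, ∀ ξ : E, ∃ P : E → E, ∀ x : E,
      ‖∫ y, osc φ ξ y * (starRingEnd ℂ) (g (y - x))‖ ≤
        C * ((1 + ‖x‖) ^ (-(N : ℝ)) + ∑ i ∈ T, (1 + ‖x - P i‖) ^ (-(N : ℝ))) := by
  obtain ⟨c, hc, T, hT⟩ := lower_bound (fderiv ℝ μ) m hm (fderiv_smoothOn μ hs)
    (fderiv_hom μ m hs hh) hhess
  obtain ⟨C₀, hC₀⟩ := W_bound φ m hm hφ hb g 0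
  obtain ⟨C₁, hC₁⟩ := W_bound φ m hm hφ hb g N
  simp only [pow_zero, one_mul] at hC₀
  have hC₀n : 0 ≤ C₀ := (norm_nonneg _).trans (hC₀ 0 0)
  have hC₁n : 0 ≤ C₁ := le_trans (by positivity) (hC₁ 0 0)
  have hm2 : 0 ≤ m - 2 := by linarith
  set q : ℝ := c / 2 ^ (m - 2) with hq
  have hqpos : 0 < q := by positivity
  set C : ℝ := 2 ^ N * (C₀ + C₁ / q ^ N) with hC
  have hCn : 0 ≤ C := by positivity
  -- generic conversion
  have hgen : ∀ D w : ℝ, 0 ≤ D → 0 ≤ w → w ≤ C₀ → (D ≤ 1 ∨ (q * D) ^ N * w ≤ C₁) →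
      w ≤ C * (1 + D) ^ (-(N : ℝ)) := by
    intro D w hD hw hw0 h
    rw [Real.rpow_neg (by positivity), Real.rpow_natCast, ← div_eq_mul_inv,
      le_div_iff₀ (by positivity), hC]
    have hx0 : 0 ≤ C₁ / q ^ N := by positivity
    by_cases hD1 : D ≤ 1
    · calc w * (1 + D) ^ N ≤ C₀ * 2 ^ N := by
            gcongr; linarith
        _ ≤ _ := by nlinarith [pow_pos (two_pos (α := ℝ)) N]
    · have h' : (q * D) ^ N * w ≤ C₁ := h.resolve_left hD1
      push Not at hD1
      have h2 : D ^ N * w ≤ C₁ / q ^ N := by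
        rw [le_div_iff₀ (by positivity)]
        rw [mul_pow] at h'; linarith
      calc w * (1 + D) ^ N ≤ w * (2 * D) ^ N := by
            gcongr; linarith
        _ = 2 ^ N * (D ^ N * w) := by rw [mul_pow]; ring
        _ ≤ 2 ^ N * (C₁ / q ^ N) := by gcongr
        _ ≤ _ := by gcongr; linarith
  refine ⟨C, hCn, T, fun ξ => ?_⟩
  obtain ⟨P, hP⟩ := hT (innerSL ℝ ξ)
  refine ⟨P, fun x => ?_⟩
  set w : ℝ := ‖∫ y, osc φ ξ y * (starRingEnd ℂ) (g (y - x))‖ with hw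
  have hwn : 0 ≤ w := norm_nonneg _
  have hw0 : w ≤ C₀ := hC₀ x ξ
  have hw1 := hC₁ x ξ
  rw [← hw] at hw1
  have hsum : 0 ≤ ∑ i ∈ T, (1 + ‖x - P i‖) ^ (-(N : ℝ)) :=
    Finset.sum_nonneg fun i _ => by positivity
  have hfst : 0 ≤ (1 + ‖x‖) ^ (-(N : ℝ)) := by positivity
  have hA : w ≤ C * (1 + ‖x‖) ^ (-(N : ℝ)) →
      w ≤ C * ((1 + ‖x‖) ^ (-(N : ℝ)) + ∑ i ∈ T, (1 + ‖x - P i‖) ^ (-(N : ℝ))) := fun h =>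
    h.trans (mul_le_mul_of_nonneg_left (by linarith) hCn)
  by_cases hx1 : ‖x‖ ≤ 1
  · exact hA (hgen _ _ (norm_nonneg _) hwn hw0 (Or.inl hx1))
  · push Not at hx1
    have hx0 : x ≠ 0 := by rintro rfl; simp at hx1; linarith
    rw [hφd x hx1.le] at hw1
    have hcmp : ∀ D : ℝ, 0 ≤ D → c * ‖x‖ ^ (m - 2) * D ≤ ‖fderiv ℝ μ x - innerSL ℝ ξ‖ →
        (q * D) ^ N * w ≤ C₁ := by
      intro D hD h
      refine le_trans ?_ hw1
      gcongr
      rw [le_div_iff₀ (by positivity)]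
      refine le_trans ?_ h
      have h3 : (1 + ‖x‖) ^ (m - 2) ≤ 2 ^ (m - 2) * ‖x‖ ^ (m - 2) := by
        rw [← Real.mul_rpow (by norm_num) (norm_nonneg _)]
        exact Real.rpow_le_rpow (by positivity) (by linarith) hm2
      calc q * D * (1 + ‖x‖) ^ (m - 2) ≤ q * D * (2 ^ (m - 2) * ‖x‖ ^ (m - 2)) := by gcongr
        _ = c * ‖x‖ ^ (m - 2) * D := by rw [hq]; field_simp
    rcases hP x hx0 with h | ⟨i, hi, h⟩
    · exact hA (hgen _ _ (norm_nonneg _) hwn hw0 (Or.inr (hcmp _ (norm_nonneg _) h)))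
    · have h4 := hgen _ _ (norm_nonneg _) hwn hw0 (Or.inr (hcmp _ (norm_nonneg _) h))
      refine h4.trans (mul_le_mul_of_nonneg_left ?_ hCn)
      have h5 := Finset.single_le_sum (f := fun i => (1 + ‖x - P i‖) ^ (-(N : ℝ)))
        (fun i _ => by positivity) hi
      linarith

theorem main {E : Type} [NormedAddCommGroup E] [InnerProductSpace ℝ E]
    [FiniteDimensional ℝ E] [MeasurableSpace E] [BorelSpace E]
    (μ : E → ℝ) (m : ℝ) (hm : 2 ≤ m)
    (hs : ContDiffOn ℝ (⊤ : ℕ∞) μ {x | x ≠ 0})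
    (hh : ∀ c : ℝ, 0 < c → ∀ x : E, x ≠ 0 → μ (c • x) = c ^ m * μ x)
    (hhess : ∀ x : E, ‖x‖ = 1 → Function.Bijective ⇑(fderiv ℝ (fderiv ℝ μ) x))
    (F : E → ℂ)
    (hF : ∀ y : E, y ≠ 0 → F y = Complex.exp (((2 * Real.pi * μ y : ℝ) : ℂ) * Complex.I))
    (hF0 : F 0 = 1) (g : SchwartzMap E ℂ) :
    (⨆ ξ : E, ∫⁻ x : E,
        (‖∫ y : E, Complex.exp (-(((2 * Real.pi * ⟪ξ, y⟫ : ℝ) : ℂ) * Complex.I)) * F y *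
              (starRingEnd ℂ) (g (y - x))‖₊ : ℝ≥0∞)) < ⊤ := by
  obtain ⟨φ, hφ, hφe, hφd, hb⟩ := exists_mod μ m hm hs hh
  set N : ℕ := Module.finrank ℝ E + 1 with hN
  obtain ⟨C, hC, T, hT⟩ := W_pointwise μ φ m hm hs hh hhess hφ hφd hb g N
  set J : ℝ≥0∞ := ∫⁻ x : E, ENNReal.ofReal ((1 + ‖x‖) ^ (-(N : ℝ))) with hJ
  have hJfin : J < ⊤ := finite_integral_one_add_norm (by rw [hN]; push_cast; linarith)
  set S : Set E := Metric.closedBall 0 1 with hS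
  have hSm : MeasurableSet S := measurableSet_closedBall
  set G : ℝ≥0∞ := ∫⁻ y, ‖g y‖ₑ with hG
  have hGfin : G < ⊤ := g.integrable.2
  set R : ℝ≥0∞ := ENNReal.ofReal C * (J + ∑ _i ∈ T, J) + 2 * (G * volume S) with hR
  have hRfin : R < ⊤ := by
    have h1 : volume S < ⊤ := measure_closedBall_lt_top
    rw [hR]
    refine ENNReal.add_lt_top.2 ⟨ENNReal.mul_lt_top ENNReal.ofReal_lt_top ?_,
      ENNReal.mul_lt_top (by simp) (ENNReal.mul_lt_top hGfin h1)⟩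
    exact ENNReal.add_lt_top.2 ⟨hJfin, ENNReal.sum_lt_top.2 fun _ _ => hJfin⟩
  refine lt_of_le_of_lt (iSup_le fun ξ => ?_) hRfin
  obtain ⟨P, hP⟩ := hT ξ
  have hFn : ∀ y, ‖F y‖ = 1 := by
    intro y
    by_cases hy : y = 0
    · rw [hy, hF0]; simp
    · rw [hF y hy]; exact Complex.norm_exp_ofReal_mul_I _
  have hexpn : ∀ y : E, ‖Complex.exp (-(((2 * Real.pi * ⟪ξ, y⟫ : ℝ) : ℂ) * Complex.I))‖ = 1 := by
    intro y
    rw [← neg_mul, ← Complex.ofReal_neg]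
    exact Complex.norm_exp_ofReal_mul_I _
  have hosc : Continuous (osc φ ξ) := by
    have := hφ.continuous
    unfold osc
    fun_prop
  have hpt : ∀ x y : E, ‖Complex.exp (-(((2 * Real.pi * ⟪ξ, y⟫ : ℝ) : ℂ) * Complex.I)) * F y *
        (starRingEnd ℂ) (g (y - x)) - osc φ ξ y * (starRingEnd ℂ) (g (y - x))‖ₑ ≤
      2 * (S.indicator 1 y * ‖g (y - x)‖ₑ) := by
    intro x y
    by_cases hy : y ∈ S
    · rw [Set.indicator_of_mem hy, Pi.one_apply, one_mul]
      refine (enorm_sub_le).trans ?_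
      have e1 : ‖Complex.exp (-(((2 * Real.pi * ⟪ξ, y⟫ : ℝ) : ℂ) * Complex.I)) * F y *
        (starRingEnd ℂ) (g (y - x))‖ₑ = ‖g (y - x)‖ₑ := by
        rw [enorm_eq_iff_norm_eq, norm_mul, norm_mul, hFn, hexpn]; simp
      have e2 : ‖osc φ ξ y * (starRingEnd ℂ) (g (y - x))‖ₑ = ‖g (y - x)‖ₑ := by
        rw [enorm_eq_iff_norm_eq, norm_mul, norm_osc]; simp
      rw [e1, e2, two_mul]
    · have hy1 : 1 ≤ ‖y‖ := by
        rw [hS, mem_closedBall_zero_iff] at hy; linarith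
      have hy0 : y ≠ 0 := by rintro rfl; simp at hy1; linarith
      have : Complex.exp (-(((2 * Real.pi * ⟪ξ, y⟫ : ℝ) : ℂ) * Complex.I)) * F y = osc φ ξ y := by
        rw [hF y hy0, osc, ← Complex.exp_add, hφe y hy1]
        congr 1
        push_cast; ring
      rw [this]; simp
  have hBint : ∀ x : E, Integrable (fun y => osc φ ξ y * (starRingEnd ℂ) (g (y - x))) := by
    intro x
    have h1 : Integrable (fun y => g (y - x)) := g.integrable.comp_sub_right x
    refine h1.norm.mono' ?_ (Filter.Eventually.of_forall fun y => ?_)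
    · have := g.continuous
      exact Continuous.aestronglyMeasurable (by fun_prop)
    · rw [norm_mul, norm_osc]; simp
  have hmeas1 : ∀ p : E, Measurable (fun x : E => ENNReal.ofReal ((1 + ‖x - p‖) ^ (-(N : ℝ)))) := by
    intro p; fun_prop
  have hWint : ∫⁻ x, ‖∫ y, osc φ ξ y * (starRingEnd ℂ) (g (y - x))‖ₑ ≤
      ENNReal.ofReal C * (J + ∑ _i ∈ T, J) := by
    calc ∫⁻ x, ‖∫ y, osc φ ξ y * (starRingEnd ℂ) (g (y - x))‖ₑ
        ≤ ∫⁻ x, ENNReal.ofReal C * (ENNReal.ofReal ((1 + ‖x‖) ^ (-(N : ℝ))) +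
            ∑ i ∈ T, ENNReal.ofReal ((1 + ‖x - P i‖) ^ (-(N : ℝ)))) := by
          refine lintegral_mono fun x => ?_
          rw [← ofReal_norm, ← ENNReal.ofReal_sum_of_nonneg (fun i _ => by positivity),
            ← ENNReal.ofReal_add (by positivity) (Finset.sum_nonneg fun i _ => by positivity),
            ← ENNReal.ofReal_mul hC]
          exact ENNReal.ofReal_le_ofReal (hP x)
      _ = _ := by
          rw [lintegral_const_mul _ (by fun_prop), lintegral_add_left (by fun_prop),
            lintegral_finsetSum _ (fun i _ => hmeas1 (P i))]
          congr 2
          refine Finset.sum_congr rfl fun i _ => ?_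
          exact lintegral_sub_right_eq_self
            (fun x : E => ENNReal.ofReal ((1 + ‖x‖) ^ (-(N : ℝ)))) (P i)
  have hEint : ∫⁻ x : E, ∫⁻ y : E, 2 * (S.indicator 1 y * ‖g (y - x)‖ₑ) ≤ 2 * (G * volume S) := by
    have hgm : Measurable g := g.continuous.measurable
    have hi : Measurable (S.indicator (1 : E → ℝ≥0∞)) := measurable_one.indicator hSm
    rw [lintegral_lintegral_swap]
    · refine le_of_eq ?_
      have : ∀ y : E, ∫⁻ x : E, 2 * (S.indicator 1 y * ‖g (y - x)‖ₑ) =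
          (2 * G) * S.indicator 1 y := by
        intro y
        rw [lintegral_const_mul _ (by fun_prop), lintegral_const_mul _ (by fun_prop),
          lintegral_sub_left_eq_self (fun z => ‖g z‖ₑ) y]
        ring
      simp_rw [this]
      rw [lintegral_const_mul _ hi, lintegral_indicator_one hSm]
      ring
    · refine Measurable.aemeasurable ?_
      simp only [Function.uncurry_def]
      fun_prop
  calc _ ≤ ∫⁻ x : E, (‖∫ y, osc φ ξ y * (starRingEnd ℂ) (g (y - x))‖ₑ +
        ∫⁻ y : E, 2 * (S.indicator 1 y * ‖g (y - x)‖ₑ)) := by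
        refine lintegral_mono fun x => ?_
        exact (norm_split volume _ _ (hBint x)).trans
          (add_le_add le_rfl (lintegral_mono fun y => hpt x y))
    _ = (∫⁻ x, ‖∫ y, osc φ ξ y * (starRingEnd ℂ) (g (y - x))‖ₑ) +
        ∫⁻ x : E, ∫⁻ y : E, 2 * (S.indicator 1 y * ‖g (y - x)‖ₑ) := by
        refine lintegral_add_right _ ?_
        have hgm : Measurable g := g.continuous.measurable
        have hi : Measurable (S.indicator (1 : E → ℝ≥0∞)) := measurable_one.indicator hSm
        refine Measurable.lintegral_prod_right' (f := fun z : E × E =>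
          2 * (S.indicator 1 z.2 * ‖g (z.2 - z.1)‖ₑ)) ?_
        fun_prop
    _ ≤ R := add_le_add hWint hEint

end Fresnel

/-- Under hypotheses (H) — `μ` smooth away from the origin, positively
homogeneous of degree `m ≥ 2`, with everywhere invertible Hessian on the unit sphere —
the generalized Fresnel function `F_μ(y) = e^{2πiμ(y)}` (with `F_μ(0) = 1`) belongs to the
modulation space `M^{1,∞}(ℝ^d)`: for every Schwartz window `g`,
`sup_ξ ∫ |V_g F_μ(x,ξ)| dx < ∞`. -/
theorem fresnel_mem_M1inf (d : ℕ) (hd : 1 ≤ d) (m : ℝ) (hm : 2 ≤ m)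
    (μ : EuclideanSpace ℝ (Fin d) → ℝ)
    (hsmooth : ContDiffOn ℝ (⊤ : ℕ∞) μ {x | x ≠ 0})
    (hhom : ∀ c : ℝ, 0 < c → ∀ x : EuclideanSpace ℝ (Fin d), x ≠ 0 →
      μ (c • x) = c ^ m * μ x)
    (hhess : ∀ x : EuclideanSpace ℝ (Fin d), ‖x‖ = 1 →
      Function.Bijective ⇑(fderiv ℝ (fderiv ℝ μ) x))
    (Fμ : EuclideanSpace ℝ (Fin d) → ℂ)
    (hFμ : ∀ y : EuclideanSpace ℝ (Fin d), y ≠ 0 →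
      Fμ y = Complex.exp (((2 * Real.pi * μ y : ℝ) : ℂ) * Complex.I))
    (hFμ0 : Fμ 0 = 1)
    (g : SchwartzMap (EuclideanSpace ℝ (Fin d)) ℂ) :
    (⨆ ξ : EuclideanSpace ℝ (Fin d),
      ∫⁻ x : EuclideanSpace ℝ (Fin d),
        (‖∫ (y : EuclideanSpace ℝ (Fin d)),
            Complex.exp (-(((2 * Real.pi * ⟪ξ, y⟫ : ℝ) : ℂ) * Complex.I)) * Fμ y *
              (starRingEnd ℂ) (g (y - x))‖₊ : ℝ≥0∞) ∂volume) < ⊤ := by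
  exact Fresnel.main μ m hm hsmooth hhom hhess Fμ hFμ hFμ0 g
end
end

section
/- Assume (H). Then there exists a unique bounded continuous function E_μ : ℝ^d → ℂ such that ∫_{ℝ^d} E_μ(x) φ(x) dx = ∫_{ℝ^d} e^{2πiμ(ξ)} (∫_{ℝ^d} e^{2πi ξ·x} φ(x) dx) dξ for every Schwartz function φ (i.e. E_μ is the inverse Fourier transform of F_μ in the sense of tempered distributions), and moreover for every Schwartz function g : ℝ^d → ℂ one has sup_{y∈ℝ^d} ∫_{ℝ^d} | ∫_{ℝ^d} e^{-2πi ξ·x} g(x−y) E_μ(x) dx | dξ < ∞ (i.e. sup_{y∈ℝ^d} ‖g(·−y)E_μ‖_{FL¹} < ∞). -/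
open MeasureTheory Real Complex
open scoped ENNReal RealInnerProductSpace

noncomputable section

namespace Fresnel

section

abbrev EV (d : ℕ) := EuclideanSpace ℝ (Fin d)

/-- standard basis vector -/
def bv {d : ℕ} (j : Fin d) : EV d := EuclideanSpace.single j (1 : ℝ)

/-- partial derivative -/
def pd {d : ℕ} {A : Type*} [NormedAddCommGroup A] [NormedSpace ℝ A] (j : Fin d)
    (f : EV d → A) (x : EV d) : A := fderiv ℝ f x (bv j)

def Us (d : ℕ) : Set (EV d) := {x | 1 / 2 < ‖x‖}

lemma isOpen_Us (d : ℕ) : IsOpen (Us d) := isOpen_lt continuous_const continuous_norm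

lemma ne_zero_of_Us {d : ℕ} {x : EV d} (hx : x ∈ Us d) : x ≠ 0 := by
  rintro rfl
  simp [Us] at hx
  linarith

/-- symbol classes of finite order on `Us d` -/
def Sym {d : ℕ} {P A : Type*} [NormedAddCommGroup A] [NormedSpace ℝ A] (W : P → EV d → ℝ) :
    ℕ → (P → EV d → A) → Prop
  | 0, f => ∃ C : ℝ, ∀ p, ∀ x ∈ Us d, ‖f p x‖ ≤ C * W p x
  | n + 1, f => (∃ C : ℝ, ∀ p, ∀ x ∈ Us d, ‖f p x‖ ≤ C * W p x) ∧
      (∀ p, ∀ x ∈ Us d, DifferentiableAt ℝ (f p) x) ∧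
      ∀ j : Fin d, Sym W n (fun p x => pd j (f p) x)

section
variable {d : ℕ} {P A : Type*} [NormedAddCommGroup A] [NormedSpace ℝ A]

lemma Sym.bound {W : P → EV d → ℝ} {n : ℕ} {f : P → EV d → A} (h : Sym W n f) :
    ∃ C : ℝ, ∀ p, ∀ x ∈ Us d, ‖f p x‖ ≤ C * W p x := by
  cases n with
  | zero => exact h
  | succ n => exact h.1

lemma Sym.pred {W : P → EV d → ℝ} {n : ℕ} {f : P → EV d → A} (h : Sym W (n + 1) f) :
    Sym W n f := by
  induction n generalizing f with
  | zero => exact h.1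
  | succ n ih => exact ⟨h.1, h.2.1, fun j => ih (h.2.2 j)⟩

lemma pd_congr {f g : EV d → A} (h : ∀ x ∈ Us d, f x = g x) (j : Fin d) :
    ∀ x ∈ Us d, pd j f x = pd j g x := by
  intro x hx
  have : f =ᶠ[nhds x] g := by
    filter_upwards [(isOpen_Us d).mem_nhds hx] with z hz using h z hz
  simp [pd, this.fderiv_eq]

lemma Sym.congr {W : P → EV d → ℝ} {n : ℕ} {f g : P → EV d → A} (h : Sym W n f)
    (hfg : ∀ p, ∀ x ∈ Us d, f p x = g p x) : Sym W n g := by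
  induction n generalizing f g with
  | zero =>
    obtain ⟨C, hC⟩ := h
    exact ⟨C, fun p x hx => by rw [← hfg p x hx]; exact hC p x hx⟩
  | succ n ih =>
    obtain ⟨⟨C, hC⟩, h2, h3⟩ := h
    refine ⟨⟨C, fun p x hx => by rw [← hfg p x hx]; exact hC p x hx⟩, fun p x hx => ?_,
      fun j => ih (h3 j) fun p => pd_congr (hfg p) j⟩
    have : f p =ᶠ[nhds x] g p := by
      filter_upwards [(isOpen_Us d).mem_nhds hx] with z hz using hfg p z hz
    exact this.differentiableAt_iff.1 (h2 p x hx)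

lemma Sym.mono {W W' : P → EV d → ℝ} {n : ℕ} {f : P → EV d → A} (h : Sym W n f)
    (K : ℝ) (hW0 : ∀ p, ∀ x ∈ Us d, 0 ≤ W p x)
    (hW : ∀ p, ∀ x ∈ Us d, W p x ≤ K * W' p x) : Sym W' n f := by
  have key : ∀ f : P → EV d → A, (∃ C : ℝ, ∀ p, ∀ x ∈ Us d, ‖f p x‖ ≤ C * W p x) →
      (∃ C : ℝ, ∀ p, ∀ x ∈ Us d, ‖f p x‖ ≤ C * W' p x) := by
    rintro f ⟨C, hC⟩
    refine ⟨|C| * K, fun p x hx => (hC p x hx).trans ?_⟩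
    calc C * W p x ≤ |C| * W p x := mul_le_mul_of_nonneg_right (le_abs_self C) (hW0 p x hx)
      _ ≤ |C| * (K * W' p x) := mul_le_mul_of_nonneg_left (hW p x hx) (abs_nonneg _)
      _ = _ := by ring
  induction n generalizing f with
  | zero => exact key f h
  | succ n ih => exact ⟨key f h.1, h.2.1, fun j => ih (h.2.2 j)⟩

lemma Sym.add {W : P → EV d → ℝ} {n : ℕ} {f g : P → EV d → A} (hf : Sym W n f)
    (hg : Sym W n g) : Sym W n (fun p x => f p x + g p x) := by
  have key : ∀ f g : P → EV d → A, (∃ C : ℝ, ∀ p, ∀ x ∈ Us d, ‖f p x‖ ≤ C * W p x) →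
      (∃ C : ℝ, ∀ p, ∀ x ∈ Us d, ‖g p x‖ ≤ C * W p x) →
      (∃ C : ℝ, ∀ p, ∀ x ∈ Us d, ‖f p x + g p x‖ ≤ C * W p x) := by
    rintro f g ⟨C, hC⟩ ⟨C', hC'⟩
    refine ⟨C + C', fun p x hx => (norm_add_le _ _).trans ?_⟩
    rw [add_mul]
    exact add_le_add (hC p x hx) (hC' p x hx)
  induction n generalizing f g with
  | zero => exact key f g hf hg
  | succ n ih =>
    refine ⟨key f g hf.1 hg.1, fun p x hx => (hf.2.1 p x hx).add (hg.2.1 p x hx), fun j => ?_⟩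
    refine (ih (hf.2.2 j) (hg.2.2 j)).congr fun p x hx => ?_
    have := fderiv_fun_add (hf.2.1 p x hx) (hg.2.1 p x hx)
    simp [pd, this]

lemma pd_zero_fun (j : Fin d) (x : EV d) : pd j (fun _ => (0 : A)) x = 0 := by
  simp [pd]

lemma Sym.zero {W : P → EV d → ℝ} {n : ℕ} :
    Sym W n (fun (_ : P) (_ : EV d) => (0 : A)) := by
  induction n with
  | zero => exact ⟨0, fun p x _ => by simp⟩
  | succ n ih =>
    refine ⟨⟨0, fun p x _ => by simp⟩, fun p x _ => by fun_prop, fun j => ?_⟩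
    simpa [pd_zero_fun] using ih

lemma Sym.const {n : ℕ} (a : A) :
    Sym (fun (_ : P) (_ : EV d) => (1 : ℝ)) n (fun (_ : P) (_ : EV d) => a) := by
  cases n with
  | zero => exact ⟨‖a‖, fun p x _ => by simp⟩
  | succ n =>
    refine ⟨⟨‖a‖, fun p x _ => by simp⟩, fun p x _ => by fun_prop, fun j => ?_⟩
    have : ∀ x : EV d, pd j (fun _ => a) x = 0 := by simp [pd]
    simpa [this] using (Sym.zero (d := d) (P := P) (A := A) (n := n))

lemma Sym.sum {ι : Type*} (s : Finset ι) {W : P → EV d → ℝ} {n : ℕ} {f : ι → P → EV d → A}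
    (hf : ∀ i, Sym W n (f i)) : Sym W n (fun p x => ∑ i ∈ s, f i p x) := by
  classical
  induction s using Finset.induction_on with
  | empty => simpa using Sym.zero
  | insert i s hi ih =>
    refine ((hf i).add ih).congr fun p x _ => ?_
    rw [Finset.sum_insert hi]

end

section
variable {d : ℕ} {P A : Type*} [NormedField A] [NormedAlgebra ℝ A]

lemma pd_mul {f g : EV d → A} {x : EV d} (hf : DifferentiableAt ℝ f x)
    (hg : DifferentiableAt ℝ g x) (j : Fin d) :
    pd j (fun x => f x * g x) x = pd j f x * g x + f x * pd j g x := by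
  have := fderiv_fun_mul hf hg
  simp [pd, this]
  ring

lemma Sym.mul {W W' : P → EV d → ℝ} {n : ℕ} {f g : P → EV d → A} (hf : Sym W n f)
    (hg : Sym W' n g) : Sym (fun p x => W p x * W' p x) n (fun p x => f p x * g p x) := by
  have key : ∀ f g : P → EV d → A, (∃ C : ℝ, ∀ p, ∀ x ∈ Us d, ‖f p x‖ ≤ C * W p x) →
      (∃ C : ℝ, ∀ p, ∀ x ∈ Us d, ‖g p x‖ ≤ C * W' p x) →
      (∃ C : ℝ, ∀ p, ∀ x ∈ Us d, ‖f p x * g p x‖ ≤ C * (W p x * W' p x)) := by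
    rintro f g ⟨C, hC⟩ ⟨C', hC'⟩
    refine ⟨C * C', fun p x hx => ?_⟩
    rw [norm_mul]
    calc ‖f p x‖ * ‖g p x‖ ≤ (C * W p x) * (C' * W' p x) :=
          mul_le_mul (hC p x hx) (hC' p x hx) (norm_nonneg _)
            ((norm_nonneg _).trans (hC p x hx))
      _ = _ := by ring
  induction n generalizing f g with
  | zero => exact key f g hf hg
  | succ n ih =>
    refine ⟨key f g hf.1 hg.1, fun p x hx => (hf.2.1 p x hx).mul (hg.2.1 p x hx), fun j => ?_⟩
    refine ((ih (hf.2.2 j) hg.pred).add (ih hf.pred (hg.2.2 j))).congr fun p x hx => ?_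
    rw [pd_mul (hf.2.1 p x hx) (hg.2.1 p x hx)]

lemma Sym.neg {W : P → EV d → ℝ} {n : ℕ} {f : P → EV d → A} (hf : Sym W n f) :
    Sym W n (fun p x => - f p x) := by
  have h := (Sym.const (d := d) (P := P) (n := n) (-1 : A)).mul hf
  simpa using h

lemma Sym.constMul {W : P → EV d → ℝ} {n : ℕ} {f : P → EV d → A} (hf : Sym W n f) (a : A) :
    Sym W n (fun p x => a * f p x) := by
  have h := (Sym.const (d := d) (P := P) (n := n) a).mul hf
  simpa using h

end

section
variable {d : ℕ} {P : Type*}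

lemma Sym.inv {q : P → EV d → ℝ} (hq1 : ∀ p x, 1 ≤ q p x) (hq : ∀ n, Sym q n q) (n : ℕ) :
    Sym (fun p x => (q p x)⁻¹) n (fun p x => (q p x)⁻¹) := by
  have hb : ∃ C : ℝ, ∀ p, ∀ x ∈ Us d, ‖(q p x)⁻¹‖ ≤ C * (q p x)⁻¹ :=
    ⟨1, fun p x _ => by
      have := hq1 p x
      rw [one_mul, Real.norm_of_nonneg (by positivity)]⟩
  induction n with
  | zero => exact hb
  | succ n ih =>
    have hd : ∀ p, ∀ x ∈ Us d, DifferentiableAt ℝ (q p) x := (hq 1).2.1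
    refine ⟨hb, fun p x hx => (hd p x hx).inv (by have := hq1 p x; positivity), fun j => ?_⟩
    have h1 := ((ih.mul ih).mul ((hq (n + 1)).2.2 j)).neg
    refine (h1.congr (g := fun p x => pd j (fun x => (q p x)⁻¹) x) fun p x hx => ?_).mono 1
      (fun p x _ => ?_) (fun p x _ => ?_)
    · have h0 : q p x ≠ 0 := by have := hq1 p x; positivity
      have h2 : HasFDerivAt (fun x => (q p x)⁻¹) _ x :=
        (hasDerivAt_inv h0).comp_hasFDerivAt x (hd p x hx).hasFDerivAt
      simp only [pd, h2.fderiv]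
      simp
      field_simp
      simp
    · have := hq1 p x
      positivity
    · have := hq1 p x
      apply le_of_eq
      field_simp

lemma pd_ofReal {f : EV d → ℝ} {x : EV d} (hf : DifferentiableAt ℝ f x) (j : Fin d) :
    pd j (fun x => (f x : ℂ)) x = ((pd j f x : ℝ) : ℂ) := by
  have h2 : HasFDerivAt (fun x => (f x : ℂ)) (Complex.ofRealCLM.comp (fderiv ℝ f x)) x :=
    Complex.ofRealCLM.hasFDerivAt.comp x hf.hasFDerivAt
  simp [pd, h2.fderiv]

lemma Sym.ofReal {W : P → EV d → ℝ} {n : ℕ} {f : P → EV d → ℝ} (hf : Sym W n f) :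
    Sym W n (fun p x => (f p x : ℂ)) := by
  have key : ∀ f : P → EV d → ℝ, (∃ C : ℝ, ∀ p, ∀ x ∈ Us d, ‖f p x‖ ≤ C * W p x) →
      (∃ C : ℝ, ∀ p, ∀ x ∈ Us d, ‖(f p x : ℂ)‖ ≤ C * W p x) := by
    rintro f ⟨C, hC⟩
    exact ⟨C, fun p x hx => by simpa using hC p x hx⟩
  induction n generalizing f with
  | zero => exact key f hf
  | succ n ih =>
    refine ⟨key f hf.1, fun p x hx => Complex.ofRealCLM.differentiableAt.comp x (hf.2.1 p x hx),
      fun j => (ih (hf.2.2 j)).congr fun p x hx => ?_⟩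
    rw [pd_ofReal (hf.2.1 p x hx)]

end

end

end Fresnel

namespace Fresnel

section

/-- smooth off the origin and homogeneous of degree `s` -/
def Hom {d : ℕ} (s : ℝ) (f : EV d → ℝ) : Prop :=
  ContDiffOn ℝ (⊤ : ℕ∞) f {x | x ≠ 0} ∧
    ∀ c : ℝ, 0 < c → ∀ x : EV d, x ≠ 0 → f (c • x) = c ^ s * f x

variable {d : ℕ}

lemma isOpen_ne0 : IsOpen {x : EV d | x ≠ 0} := isOpen_ne

lemma Hom.contDiffAt {s : ℝ} {f : EV d → ℝ} (h : Hom s f) {x : EV d} (hx : x ≠ 0) :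
    ContDiffAt ℝ (⊤ : ℕ∞) f x := h.1.contDiffAt (isOpen_ne0.mem_nhds hx)

lemma Hom.diff {s : ℝ} {f : EV d → ℝ} (h : Hom s f) {x : EV d} (hx : x ≠ 0) :
    DifferentiableAt ℝ f x := (h.contDiffAt hx).differentiableAt (by simp)

lemma Hom.fderiv_smul {s : ℝ} {f : EV d → ℝ} (h : Hom s f) {c : ℝ} (hc : 0 < c) {x : EV d}
    (hx : x ≠ 0) : fderiv ℝ f (c • x) = c ^ (s - 1) • fderiv ℝ f x := by
  have hcx : c • x ≠ 0 := smul_ne_zero hc.ne' hx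
  have h1 : HasFDerivAt (fun z : EV d => f (c • z))
      ((fderiv ℝ f (c • x)).comp (c • ContinuousLinearMap.id ℝ (EV d))) x :=
    HasFDerivAt.comp x (h.diff hcx).hasFDerivAt ((hasFDerivAt_id x).const_smul c)
  have h2 : HasFDerivAt (fun z : EV d => c ^ s * f z) (c ^ s • fderiv ℝ f x) x :=
    (h.diff hx).hasFDerivAt.const_mul _
  have h3 : (fun z : EV d => f (c • z)) =ᶠ[nhds x] (fun z : EV d => c ^ s * f z) := by
    filter_upwards [isOpen_ne0.mem_nhds hx] with z hz using h.2 c hc z hz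
  have h4 := (h1.congr_of_eventuallyEq h3.symm).unique h2
  have h5 : c • fderiv ℝ f (c • x) = c ^ s • fderiv ℝ f x := by
    rw [← h4]; ext v; simp
  rw [Real.rpow_sub_one hc.ne', div_eq_inv_mul, mul_smul, ← h5, smul_smul,
    inv_mul_cancel₀ hc.ne', one_smul]

lemma Hom.pd {s : ℝ} {f : EV d → ℝ} (h : Hom s f) (j : Fin d) : Hom (s - 1) (pd j f) := by
  constructor
  · have h1 : ContDiffOn ℝ (⊤ : ℕ∞) (fderiv ℝ f) {x | x ≠ 0} :=
      h.1.fderiv_of_isOpen isOpen_ne0 (by simp)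
    exact h1.clm_apply contDiffOn_const
  · intro c hc x hx
    simp [Fresnel.pd, h.fderiv_smul hc hx]

lemma Hom.mul {s t : ℝ} {f g : EV d → ℝ} (hf : Hom s f) (hg : Hom t g) :
    Hom (s + t) (fun x => f x * g x) := by
  refine ⟨hf.1.mul hg.1, fun c hc x hx => ?_⟩
  simp only [hf.2 c hc x hx, hg.2 c hc x hx, Real.rpow_add hc]
  ring

lemma hom_norm (s : ℝ) : Hom s (fun x : EV d => ‖x‖ ^ s) := by
  constructor
  · intro x hx
    exact ((contDiffAt_norm ℝ hx).rpow_const_of_ne (norm_ne_zero_iff.2 hx)).contDiffWithinAt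
  · intro c hc x hx
    simp only [norm_smul, Real.norm_of_nonneg hc.le]
    rw [Real.mul_rpow hc.le (norm_nonneg _)]

lemma Hom.bound {s : ℝ} {f : EV d → ℝ} (h : Hom s f) :
    ∃ C : ℝ, 0 ≤ C ∧ ∀ x : EV d, x ≠ 0 → |f x| ≤ C * ‖x‖ ^ s := by
  have hc : ContinuousOn f (Metric.sphere (0 : EV d) 1) :=
    h.1.continuousOn.mono fun x hx => by
      rintro rfl
      simp at hx
  obtain ⟨C, hC⟩ := (isCompact_sphere (0 : EV d) 1).exists_bound_of_continuousOn hc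
  refine ⟨|C|, abs_nonneg _, fun x hx => ?_⟩
  have hn : 0 < ‖x‖ := norm_pos_iff.2 hx
  have h1 : ‖(‖x‖⁻¹ • x)‖ = 1 := by
    rw [norm_smul, norm_inv, norm_norm, inv_mul_cancel₀ hn.ne']
  have h2 := h.2 ‖x‖ hn (‖x‖⁻¹ • x) (smul_ne_zero (inv_ne_zero hn.ne') hx)
  rw [smul_smul, mul_inv_cancel₀ hn.ne', one_smul] at h2
  rw [h2, abs_mul, abs_of_nonneg (by positivity), mul_comm]
  have h3 := hC (‖x‖⁻¹ • x) (by simpa using h1)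
  exact mul_le_mul_of_nonneg_right (h3.trans (le_abs_self C)) (by positivity)

lemma Hom.sym {P : Type*} {s : ℝ} {f : EV d → ℝ} (h : Hom s f) (hs : s ≤ 0) (n : ℕ) :
    Sym (fun (_ : P) (_ : EV d) => (1 : ℝ)) n (fun (_ : P) x => f x) := by
  have key : ∀ (s : ℝ) (f : EV d → ℝ), Hom s f → s ≤ 0 →
      (∃ C : ℝ, ∀ (_ : P), ∀ x ∈ Us d, ‖f x‖ ≤ C * 1) := by
    intro s f h hs
    obtain ⟨C, hC0, hC⟩ := h.bound
    refine ⟨C * (1 / 2) ^ s, fun _ x hx => ?_⟩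
    rw [mul_one, Real.norm_eq_abs]
    refine (hC x (ne_zero_of_Us hx)).trans (mul_le_mul_of_nonneg_left ?_ hC0)
    exact Real.rpow_le_rpow_of_nonpos (by norm_num) (le_of_lt hx) hs
  induction n generalizing s f with
  | zero => exact key s f h hs
  | succ n ih =>
    exact ⟨key s f h hs, fun p x hx => h.diff (ne_zero_of_Us hx), fun j => ih (h.pd j) (by linarith)⟩

/-! weights attached to `μ` -/

def rho (m : ℝ) (x : EV d) : ℝ := ‖x‖ ^ (2 - m)

def ww (m : ℝ) (μ : EV d → ℝ) (j : Fin d) (p : EV d × EV d) (x : EV d) : ℝ :=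
  (pd j μ x + p.2 j) * rho m x

def qq (m : ℝ) (μ : EV d → ℝ) (p : EV d × EV d) (x : EV d) : ℝ :=
  1 + ∑ j, ww m μ j p x * ww m μ j p x

def RR (m : ℝ) (μ : EV d → ℝ) (p : EV d × EV d) (x : EV d) : ℝ := √(qq m μ p x)

lemma one_le_qq (m : ℝ) (μ : EV d → ℝ) (p x) : 1 ≤ qq m μ p x := by
  have : 0 ≤ ∑ j, ww m μ j p x * ww m μ j p x := Finset.sum_nonneg fun j _ => mul_self_nonneg _
  unfold qq; linarith

lemma one_le_RR (m : ℝ) (μ : EV d → ℝ) (p x) : 1 ≤ RR m μ p x :=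
  Real.one_le_sqrt.2 (one_le_qq m μ p x)

lemma RR_mul_self (m : ℝ) (μ : EV d → ℝ) (p x) : RR m μ p x * RR m μ p x = qq m μ p x :=
  Real.mul_self_sqrt (zero_le_one.trans (one_le_qq m μ p x))

lemma abs_ww_le (m : ℝ) (μ : EV d → ℝ) (j p x) : |ww m μ j p x| ≤ RR m μ p x := by
  apply Real.abs_le_sqrt
  have : ww m μ j p x * ww m μ j p x ≤ ∑ j, ww m μ j p x * ww m μ j p x :=
    Finset.single_le_sum (f := fun j => ww m μ j p x * ww m μ j p x)
      (fun j _ => mul_self_nonneg _) (Finset.mem_univ j)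
  unfold qq; nlinarith

lemma sym_ww {m : ℝ} (hm : 2 ≤ m) {μ : EV d → ℝ} (hμ : Hom m μ) (j : Fin d) (n : ℕ) :
    Sym (RR m μ) n (ww m μ j) := by
  have hb : ∃ C : ℝ, ∀ p, ∀ x ∈ Us d, ‖ww m μ j p x‖ ≤ C * RR m μ p x :=
    ⟨1, fun p x _ => by rw [one_mul]; exact abs_ww_le m μ j p x⟩
  have hρ : Hom (2 - m) (rho m : EV d → ℝ) := hom_norm (2 - m)
  induction n with
  | zero => exact hb
  | succ n ih =>
    refine ⟨hb, fun p x hx => ?_, fun k => ?_⟩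
    · have hx0 := ne_zero_of_Us hx
      exact (((hμ.pd j).diff hx0).add_const _).mul (hρ.diff hx0)
    · have h1 : Hom (m - 1 - 1 + (2 - m)) (fun x => pd k (pd j μ) x * rho m x) :=
        ((hμ.pd j).pd k).mul hρ
      have h2 : Hom (2 - m - 1 + (m - 2)) (fun x : EV d => pd k (rho m) x * ‖x‖ ^ (m - 2)) :=
        (hρ.pd k).mul (hom_norm (m - 2))
      have h3 := (h1.sym (P := EV d × EV d) (by linarith) n).mono (W' := RR m μ) 1
        (fun _ _ _ => zero_le_one) (fun p x _ => by rw [one_mul]; exact one_le_RR m μ p x)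
      have h4 := ih.mul (h2.sym (P := EV d × EV d) (by linarith) n)
      simp only [mul_one] at h4
      refine (h3.add h4).congr fun p x hx => ?_
      have hx0 := ne_zero_of_Us hx
      have h5 : pd k (ww m μ j p) x = _ :=
        pd_mul (((hμ.pd j).diff hx0).add_const (p.2 j)) (hρ.diff hx0) k
      rw [h5]
      have h6 : pd k (fun x => pd j μ x + p.2 j) x = pd k (pd j μ) x := by
        simp [pd]
        rfl
      rw [h6]
      have h7 : rho m x * ‖x‖ ^ (m - 2) = 1 := by
        rw [rho, ← Real.rpow_add (norm_pos_iff.2 hx0)]; simp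
      have : ww m μ j p x * (pd k (rho m) x * ‖x‖ ^ (m - 2)) =
        (pd j μ x + p.2 j) * pd k (rho m) x * (rho m x * ‖x‖ ^ (m - 2)) := by unfold ww; ring
      rw [this, h7, mul_one]

lemma sym_qq {m : ℝ} (hm : 2 ≤ m) {μ : EV d → ℝ} (hμ : Hom m μ) (n : ℕ) :
    Sym (qq m μ) n (qq m μ) := by
  have h1 : Sym (qq m μ) n (fun p x => ∑ j, ww m μ j p x * ww m μ j p x) :=
    Sym.sum _ fun j => by
      simpa only [RR_mul_self] using (sym_ww hm hμ j n).mul (sym_ww hm hμ j n)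
  have h2 : Sym (qq m μ) n (fun p x => (1 : ℝ)) :=
    (Sym.const (1 : ℝ)).mono 1 (fun _ _ _ => zero_le_one)
      (fun p x _ => by rw [one_mul]; exact one_le_qq m μ p x)
  exact h2.add h1

def cc (m : ℝ) (μ : EV d → ℝ) (j : Fin d) (p : EV d × EV d) (x : EV d) : ℝ :=
  ww m μ j p x * rho m x * (qq m μ p x)⁻¹

lemma sym_qinv {m : ℝ} (hm : 2 ≤ m) {μ : EV d → ℝ} (hμ : Hom m μ) (n : ℕ) :
    Sym (fun p x => (qq m μ p x)⁻¹) n (fun p x => (qq m μ p x)⁻¹) :=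
  Sym.inv (one_le_qq m μ) (sym_qq hm hμ) n

lemma sym_cc {m : ℝ} (hm : 2 ≤ m) {μ : EV d → ℝ} (hμ : Hom m μ) (j : Fin d) (n : ℕ) :
    Sym (fun p x => (RR m μ p x)⁻¹) n (cc m μ j) := by
  have hρ : Hom (2 - m) (rho m : EV d → ℝ) := hom_norm (2 - m)
  have h := ((sym_ww hm hμ j n).mul (hρ.sym (P := EV d × EV d) (by linarith) n)).mul
    (sym_qinv hm hμ n)
  refine h.mono 1 (fun p x _ => ?_) (fun p x _ => ?_)
  · have := one_le_qq m μ p x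
    have := one_le_RR m μ p x
    positivity
  · have := one_le_RR m μ p x
    rw [← RR_mul_self]
    apply le_of_eq
    field_simp

end

end Fresnel

namespace Fresnel

section

variable {d : ℕ}

section
variable {E : Type*} [NormedAddCommGroup E] [InnerProductSpace ℝ E] [FiniteDimensional ℝ E]

lemma fderiv_smul_gen {F : Type*} [NormedAddCommGroup F] [NormedSpace ℝ F] {s : ℝ}
    {f : E → F} (hd : ∀ x, x ≠ 0 → DifferentiableAt ℝ f x)
    (h : ∀ c : ℝ, 0 < c → ∀ x : E, x ≠ 0 → f (c • x) = c ^ s • f x) {c : ℝ} (hc : 0 < c)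
    {x : E} (hx : x ≠ 0) : fderiv ℝ f (c • x) = c ^ (s - 1) • fderiv ℝ f x := by
  have hcx : c • x ≠ 0 := smul_ne_zero hc.ne' hx
  have h1 : HasFDerivAt (fun z : E => f (c • z))
      ((fderiv ℝ f (c • x)).comp (c • ContinuousLinearMap.id ℝ (E))) x :=
    HasFDerivAt.comp x (hd _ hcx).hasFDerivAt ((hasFDerivAt_id x).const_smul c)
  have h2 : HasFDerivAt (fun z : E => c ^ s • f z) (c ^ s • fderiv ℝ f x) x :=
    (hd _ hx).hasFDerivAt.const_smul _
  have h3 : (fun z : E => f (c • z)) =ᶠ[nhds x] (fun z : E => c ^ s • f z) := by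
    filter_upwards [isOpen_ne.mem_nhds hx] with z hz using h c hc z hz
  have h4 := (h1.congr_of_eventuallyEq h3.symm).unique h2
  have h5 : c • fderiv ℝ f (c • x) = c ^ s • fderiv ℝ f x := by
    rw [← h4]; ext v; simp
  rw [Real.rpow_sub_one hc.ne', div_eq_inv_mul, mul_smul, ← h5, smul_smul,
    inv_mul_cancel₀ hc.ne', one_smul]

lemma close_aux {F : Type*} [NormedAddCommGroup F] [NormedSpace ℝ F] {A B : E →L[ℝ] F} {ε r : ℝ}
    (hr : 0 ≤ r) (h : dist A B < ε) (v : E) : ‖r • A v - r • B v‖ ≤ r * ε * ‖v‖ := by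
  rw [← smul_sub, norm_smul, Real.norm_of_nonneg hr, mul_assoc]
  refine mul_le_mul_of_nonneg_left ?_ hr
  rw [dist_eq_norm] at h
  exact ((A - B).le_opNorm v).trans (mul_le_mul_of_nonneg_right h.le (norm_nonneg _))

/-- circular cone -/
def Cone (v0 : E) (κ : ℝ) : Set (E) := {x | κ * ‖x‖ < ⟪x, v0⟫}

lemma cone_segment {v0 : E} {κ : ℝ} (hκ : 0 ≤ κ) {x x' : E} (hx : x ∈ Cone v0 κ)
    (hx' : x' ∈ Cone v0 κ) {t : ℝ} (h0 : 0 ≤ t) (h1 : t ≤ 1) :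
    x' + t • (x - x') ∈ Cone v0 κ := by
  simp only [Cone, Set.mem_ofPred_eq] at *
  have e : x' + t • (x - x') = t • x + (1 - t) • x' := by
    rw [smul_sub, sub_smul, one_smul]; abel
  rw [e, inner_add_left, inner_smul_left, inner_smul_left]
  have hn : ‖t • x + (1 - t) • x'‖ ≤ t * ‖x‖ + (1 - t) * ‖x'‖ := by
    refine (norm_add_le _ _).trans ?_
    rw [norm_smul, norm_smul, Real.norm_of_nonneg h0, Real.norm_of_nonneg (by linarith)]
  have h3 := mul_le_mul_of_nonneg_left hn hκ
  simp only [conj_trivial]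
  rcases h0.eq_or_lt with h | h
  · subst h; simp at *; linarith
  · nlinarith [mul_lt_mul_of_pos_left hx h, mul_le_mul_of_nonneg_left hx'.le (sub_nonneg.2 h1)]

lemma cone_ne_zero {v0 : E} {κ : ℝ} {x : E} (hx : x ∈ Cone v0 κ) : x ≠ 0 := by
  rintro rfl
  simp [Cone] at hx

set_option maxHeartbeats 1000000 in
lemma cone_lower {m : ℝ} (hm : 2 ≤ m) {μ : E → ℝ} (hμc : ContDiffOn ℝ (⊤ : ℕ∞) μ {x | x ≠ 0})
    (hμh : ∀ c : ℝ, 0 < c → ∀ x : E, x ≠ 0 → μ (c • x) = c ^ m * μ x)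
    (hhess : ∀ x : E, ‖x‖ = 1 → Function.Bijective ⇑(fderiv ℝ (fderiv ℝ μ) x))
    {v0 : E} (hv0 : ‖v0‖ = 1) :
    ∃ κ : ℝ, κ < 1 ∧ ∃ c : ℝ, 0 < c ∧ ∀ x ∈ Cone v0 κ, ∀ x' ∈ Cone v0 κ,
      c * ‖x‖ ^ (m - 2) * ‖x - x'‖ ≤ ‖fderiv ℝ μ x - fderiv ℝ μ x'‖ := by
  have hv00 : v0 ≠ 0 := by
    rintro rfl
    simp at hv0
  have hD : ContDiffOn ℝ (⊤ : ℕ∞) (fderiv ℝ μ) {x | x ≠ 0} :=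
    hμc.fderiv_of_isOpen isOpen_ne (by simp)
  have hDd : ∀ x : E, x ≠ 0 → DifferentiableAt ℝ (fderiv ℝ μ) x := fun x hx =>
    (hD.contDiffAt (isOpen_ne.mem_nhds hx)).differentiableAt (by simp)
  have hH : ContDiffOn ℝ (⊤ : ℕ∞) (fderiv ℝ (fderiv ℝ μ)) {x | x ≠ 0} :=
    hD.fderiv_of_isOpen isOpen_ne (by simp)
  have hHh : ∀ c : ℝ, 0 < c → ∀ x : E, x ≠ 0 →
      fderiv ℝ (fderiv ℝ μ) (c • x) = c ^ (m - 2) • fderiv ℝ (fderiv ℝ μ) x := by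
    intro c hc x hx
    have := fderiv_smul_gen hDd (s := m - 1) (fun c hc x hx => fderiv_smul_gen
      (fun x hx => (hμc.contDiffAt (isOpen_ne.mem_nhds hx)).differentiableAt (by simp)) hμh hc hx) hc hx
    rw [this]; congr 2; ring
  set H := fderiv ℝ (fderiv ℝ μ) with hHdef
  obtain ⟨K, hK0, hK⟩ := (LinearMap.exists_antilipschitzWith (H v0).toLinearMap
    (LinearMap.ker_eq_bot.2 (hhess v0 hv0).1))
  set c0 : ℝ := (K : ℝ)⁻¹ with hc0
  have hc0p : 0 < c0 := by positivity
  have hc0b : ∀ v, c0 * ‖v‖ ≤ ‖H v0 v‖ := by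
    intro v
    have h1 : ‖v‖ ≤ K * ‖H v0 v‖ := by
      simpa using hK.le_mul_dist v 0
    rw [hc0, inv_mul_le_iff₀ (by positivity)]
    exact h1
  have hcont : ContinuousAt H v0 := hH.continuousOn.continuousAt (isOpen_ne.mem_nhds hv00)
  obtain ⟨δ, hδ, hδH⟩ := (Metric.continuousAt_iff (f := H) (a := v0)).1 hcont (c0 / 4) (by positivity)
  refine ⟨max (1 / 2) (1 - δ ^ 2 / 4), by
    apply max_lt (by norm_num); nlinarith, 1 / 2 * (1 / 4) ^ (m - 2) * (c0 / 4), by positivity, ?_⟩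
  set κ := max (1 / 2) (1 - δ ^ 2 / 4) with hκ
  have hκ1 : 1 / 2 ≤ κ := le_max_left _ _
  have hκ2 : 1 - δ ^ 2 / 4 ≤ κ := le_max_right _ _
  -- closeness of Hessian
  have hclose : ∀ z ∈ Cone v0 κ, ∀ v, ‖H z v - ‖z‖ ^ (m - 2) • H v0 v‖ ≤
      ‖z‖ ^ (m - 2) * (c0 / 4) * ‖v‖ := by
    intro z hz v
    have hz0 := cone_ne_zero hz
    have hn : 0 < ‖z‖ := norm_pos_iff.2 hz0
    have h1 : ‖(‖z‖⁻¹ • z)‖ = 1 := by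
      rw [norm_smul, norm_inv, norm_norm, inv_mul_cancel₀ hn.ne']
    have h2 := hHh ‖z‖ hn (‖z‖⁻¹ • z) (smul_ne_zero (inv_ne_zero hn.ne') hz0)
    rw [smul_smul, mul_inv_cancel₀ hn.ne', one_smul] at h2
    have h2' : H z v = ‖z‖ ^ (m - 2) • H (‖z‖⁻¹ • z) v := by
      conv_lhs => rw [h2]
      rfl
    rw [h2']
    refine close_aux (by positivity) (hδH ?_) v
    rw [dist_eq_norm]
    refine lt_of_pow_lt_pow_left₀ 2 hδ.le ?_
    rw [norm_sub_sq_real, h1, hv0, inner_smul_left]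
    have h3 : κ < ‖z‖⁻¹ * ⟪z, v0⟫ := by
      rw [lt_inv_mul_iff₀ hn]
      simpa [Cone, mul_comm] using hz
    simp only [conj_trivial]
    nlinarith
  intro x hx x' hx'
  set v := x - x' with hv
  rcases eq_or_ne v 0 with hv0' | hvne
  · simp [hv0']
  have hvpos : 0 < ‖v‖ := norm_pos_iff.2 hvne
  obtain ⟨u, hu⟩ : ∃ u, c0 / 2 * ‖v‖ * ‖u‖ < H v0 v u := by
    by_contra hcon
    push Not at hcon
    have h1 : ‖H v0 v‖ ≤ c0 / 2 * ‖v‖ := by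
      refine ContinuousLinearMap.opNorm_le_bound _ (by positivity) fun u => ?_
      rw [Real.norm_eq_abs, abs_le]
      have h1 := hcon u
      have h2 := hcon (-u)
      rw [norm_neg, map_neg] at h2
      constructor <;> linarith
    have := hc0b v
    nlinarith
  have hupos : 0 < ‖u‖ := by
    rw [norm_pos_iff]
    rintro rfl
    simp at hu
  have hder : ∀ z ∈ Cone v0 κ, ‖z‖ ^ (m - 2) * (c0 / 4 * ‖v‖ * ‖u‖) ≤ H z v u := by
    intro z hz
    have h1 : |(H z v - ‖z‖ ^ (m - 2) • H v0 v) u| ≤ ‖z‖ ^ (m - 2) * (c0 / 4) * ‖v‖ * ‖u‖ := by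
      refine ((H z v - ‖z‖ ^ (m - 2) • H v0 v).le_opNorm u).trans ?_
      exact mul_le_mul_of_nonneg_right (hclose z hz v) hupos.le
    have h2 := (abs_le.1 h1).1
    simp only [sub_apply, smul_apply, smul_eq_mul] at h2
    have hn : 0 ≤ ‖z‖ ^ (m - 2) := by positivity
    nlinarith [mul_le_mul_of_nonneg_left hu.le hn]
  let h : ℝ → ℝ := fun t => fderiv ℝ μ (x' + t • v) u
  have hseg : ∀ t ∈ Set.Icc (0 : ℝ) 1, x' + t • v ∈ Cone v0 κ := fun t ht =>
    cone_segment (by linarith) hx hx' ht.1 ht.2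
  have hhd : ∀ t ∈ Set.Icc (0 : ℝ) 1, HasDerivAt h (H (x' + t • v) v u) t := by
    intro t ht
    have h1 : HasDerivAt (fun t : ℝ => x' + t • v) v t := by
      simpa using ((hasDerivAt_id t).smul_const v).const_add x'
    have h2 := (hDd _ (cone_ne_zero (hseg t ht))).hasFDerivAt.comp_hasDerivAt t h1
    exact (h2.clm_apply (hasDerivAt_const t u)).congr_deriv (by simp [hHdef])
  have hhc : ContinuousOn h (Set.Icc 0 1) := fun t ht =>
    (hhd t ht).continuousAt.continuousWithinAt
  obtain ⟨t1, ht1, e1⟩ := exists_hasDerivAt_eq_slope h (fun t => H (x' + t • v) v u)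
    (show (0 : ℝ) < 1 / 2 by norm_num) (hhc.mono (Set.Icc_subset_Icc le_rfl (by norm_num)))
    (fun t ht => hhd t ⟨ht.1.le, by linarith [ht.2]⟩)
  obtain ⟨t2, ht2, e2⟩ := exists_hasDerivAt_eq_slope h (fun t => H (x' + t • v) v u)
    (show (1 / 2 : ℝ) < 1 by norm_num) (hhc.mono (Set.Icc_subset_Icc (by norm_num) le_rfl))
    (fun t ht => hhd t ⟨by linarith [ht.1], ht.2.le⟩)
  have g1 := hder _ (hseg t1 ⟨ht1.1.le, by linarith [ht1.2]⟩)
  have g1' : 0 ≤ ‖x' + t1 • v‖ ^ (m - 2) * (c0 / 4 * ‖v‖ * ‖u‖) := by positivity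
  have g2 := hder _ (hseg t2 ⟨by linarith [ht2.1], ht2.2.le⟩)
  have hnorm : 1 / 4 * ‖x‖ ≤ ‖x' + t2 • v‖ := by
    have i1 : ⟪x' + t2 • v, v0⟫ ≤ ‖x' + t2 • v‖ := by
      simpa [hv0] using real_inner_le_norm (x' + t2 • v) v0
    have e : x' + t2 • v = t2 • x + (1 - t2) • x' := by
      rw [hv, smul_sub, sub_smul, one_smul]; abel
    have i2 : ⟪x' + t2 • v, v0⟫ = t2 * ⟪x, v0⟫ + (1 - t2) * ⟪x', v0⟫ := by
      rw [e, inner_add_left, inner_smul_left, inner_smul_left]; simp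
    have i3 : κ * ‖x‖ < ⟪x, v0⟫ := hx
    have i4 : κ * ‖x'‖ < ⟪x', v0⟫ := hx'
    have i5 : 0 ≤ ⟪x', v0⟫ := by nlinarith [norm_nonneg x']
    have i6 : 1 / 2 * ‖x‖ ≤ ⟪x, v0⟫ := by nlinarith [norm_nonneg x]
    have i7 : 1 / 2 * (1 / 2 * ‖x‖) ≤ t2 * ⟪x, v0⟫ :=
      mul_le_mul ht2.1.le i6 (by positivity) (by linarith [ht2.1])
    have i8 : 0 ≤ (1 - t2) * ⟪x', v0⟫ := mul_nonneg (by linarith [ht2.2]) i5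
    linarith
  have hpow : (1 / 4) ^ (m - 2) * ‖x‖ ^ (m - 2) ≤ ‖x' + t2 • v‖ ^ (m - 2) := by
    rw [← Real.mul_rpow (by norm_num) (norm_nonneg _)]
    exact Real.rpow_le_rpow (by positivity) hnorm (by linarith)
  have hfin : h 1 - h 0 ≤ ‖fderiv ℝ μ x - fderiv ℝ μ x'‖ * ‖u‖ := by
    have : h 1 - h 0 = (fderiv ℝ μ x - fderiv ℝ μ x') u := by
      simp [h, hv]
    rw [this]
    exact (Real.le_norm_self _).trans (ContinuousLinearMap.le_opNorm _ _)
  have e1' : h (1 / 2) - h 0 ≥ 0 := by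
    have : H (x' + t1 • v) v u = (h (1 / 2) - h 0) * 2 := e1.trans (by ring)
    have h9 := g1'.trans (g1.trans_eq this)
    linarith
  have e2' : h 1 - h (1 / 2) ≥ 1 / 2 * (‖x' + t2 • v‖ ^ (m - 2) * (c0 / 4 * ‖v‖ * ‖u‖)) := by
    have : H (x' + t2 • v) v u = (h 1 - h (1 / 2)) * 2 := e2.trans (by ring)
    have h9 := g2.trans_eq this
    linarith
  have hp2 := mul_le_mul_of_nonneg_right hpow (show 0 ≤ c0 / 4 * ‖v‖ * ‖u‖ by positivity)
  refine le_of_mul_le_mul_right ?_ hupos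
  linarith

end

lemma dual_le_RR (m : ℝ) (μ : EV d → ℝ) (p : EV d × EV d) (x : EV d) :
    ‖fderiv ℝ μ x + innerSL ℝ p.2‖ * rho m x ≤ RR m μ p x := by
  have hρ : 0 ≤ rho m x := Real.rpow_nonneg (norm_nonneg _) _
  have key : ‖rho m x • (fderiv ℝ μ x + innerSL ℝ p.2)‖ ≤ RR m μ p x := by
    refine ContinuousLinearMap.opNorm_le_bound _ (zero_le_one.trans (one_le_RR m μ p x))
      fun u => ?_
    have hu : u = ∑ j, u j • bv j := by
      have := (EuclideanSpace.basisFun (Fin d) ℝ).sum_repr u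
      simpa [bv] using this.symm
    have h1 : (rho m x • (fderiv ℝ μ x + innerSL ℝ p.2)) u = ∑ j, ww m μ j p x * u j := by
      conv_lhs => rw [hu]
      rw [map_sum]
      refine Finset.sum_congr rfl fun j _ => ?_
      have : ⟪p.2, bv j⟫ = p.2 j := by
        rw [bv, EuclideanSpace.inner_single_right]; simp
      simp only [map_smul, smul_apply, add_apply,
        innerSL_apply_apply, this, smul_eq_mul, ww, pd]
      ring
    rw [h1, Real.norm_eq_abs]
    refine abs_le_of_sq_le_sq ?_ (mul_nonneg (zero_le_one.trans (one_le_RR m μ p x)) (norm_nonneg _))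
    have h2 := Finset.sum_mul_sq_le_sq_mul_sq Finset.univ (fun j => ww m μ j p x) (fun j => u j)
    refine h2.trans ?_
    rw [mul_pow, sq (RR m μ p x), RR_mul_self, EuclideanSpace.real_norm_sq_eq]
    refine mul_le_mul_of_nonneg_right ?_ (Finset.sum_nonneg fun _ _ => sq_nonneg _)
    unfold qq
    simp only [sq]
    linarith
  rwa [norm_smul, Real.norm_of_nonneg hρ, mul_comm] at key

lemma rho_le {m : ℝ} (hm : 2 ≤ m) {x : EV d} (hx : x ∈ Us d) :
    rho m x ≤ (1 / 2) ^ (2 - m) :=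
  Real.rpow_le_rpow_of_nonpos (by norm_num) (le_of_lt hx) (by linarith)

/-- the integral weight -/
def kR (m : ℝ) (μ : EV d → ℝ) (N : ℕ) (p : EV d × EV d) (x : EV d) : ℝ≥0∞ :=
  ENNReal.ofReal ((RR m μ p x)⁻¹ ^ N)

lemma cone_lint {m : ℝ} (hm : 2 ≤ m) {μ : EV d → ℝ} {S : Set (EV d)} (hS : S ⊆ Us d)
    {c : ℝ} (hc : 0 < c)
    (hlow : ∀ x ∈ S, ∀ x' ∈ S,
      c * ‖x‖ ^ (m - 2) * ‖x - x'‖ ≤ ‖fderiv ℝ μ x - fderiv ℝ μ x'‖) :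
    ∃ C : ℝ≥0∞, C < ⊤ ∧ ∀ p : EV d × EV d, ∫⁻ x in S, kR m μ (d + 1) p x ≤ C := by
  set K : ℝ := (1 / 2) ^ (2 - m) with hK
  have hK0 : 0 ≤ K := by positivity
  set L : ℝ := 1 + (2 + K) / c with hL
  have hL0 : 0 ≤ L := by positivity
  refine ⟨ENNReal.ofReal (L ^ (d + 1)) *
    ∫⁻ x : EV d, ENNReal.ofReal ((1 + ‖x‖) ^ (-((d + 1 : ℕ) : ℝ))),
    ENNReal.mul_lt_top ENNReal.ofReal_lt_top
      (finite_integral_one_add_norm (by simp)), fun p => ?_⟩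
  rcases S.eq_empty_or_nonempty with rfl | hne
  · simp
  set A : EV d → ℝ := fun x => ‖fderiv ℝ μ x + innerSL ℝ p.2‖ with hA
  have hbdd : BddBelow (A '' S) := ⟨0, by rintro _ ⟨x, _, rfl⟩; exact norm_nonneg _⟩
  obtain ⟨_, ⟨x0, hx0, rfl⟩, hlt⟩ := exists_lt_of_csInf_lt (hne.image A)
    (show sInf (A '' S) < sInf (A '' S) + 1 by linarith)
  have hmain : ∀ x ∈ S, (1 + ‖x - x0‖) ≤ L * RR m μ p x := by
    intro x hx
    have hxU := hS hx
    have hxp : 0 < ‖x‖ := norm_pos_iff.2 (ne_zero_of_Us hxU)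
    have h1 := hlow x hx x0 hx0
    have h2 : ‖fderiv ℝ μ x - fderiv ℝ μ x0‖ ≤ A x + A x0 := by
      have : fderiv ℝ μ x - fderiv ℝ μ x0 =
        (fderiv ℝ μ x + innerSL ℝ p.2) - (fderiv ℝ μ x0 + innerSL ℝ p.2) := by abel
      rw [this]; exact norm_sub_le _ _
    have h3 : sInf (A '' S) ≤ A x := csInf_le hbdd ⟨x, hx, rfl⟩
    have h4 : c * ‖x‖ ^ (m - 2) * ‖x - x0‖ ≤ 2 * A x + 1 := by linarith
    have hρ0 : 0 ≤ rho m x := Real.rpow_nonneg (norm_nonneg _) _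
    have h5 := mul_le_mul_of_nonneg_right h4 hρ0
    have h6 : ‖x‖ ^ (m - 2) * rho m x = 1 := by
      rw [rho, ← Real.rpow_add hxp]; simp
    have h7 : c * ‖x - x0‖ ≤ 2 * (A x * rho m x) + rho m x := by
      calc c * ‖x - x0‖ = c * ‖x - x0‖ * (‖x‖ ^ (m - 2) * rho m x) := by rw [h6, mul_one]
        _ = c * ‖x‖ ^ (m - 2) * ‖x - x0‖ * rho m x := by ring
        _ ≤ _ := h5
        _ = _ := by ring
    have h8 : A x * rho m x ≤ RR m μ p x := dual_le_RR m μ p x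
    have h9 : rho m x ≤ K := rho_le hm hxU
    have h10 := one_le_RR m μ p x
    have h11 : c * ‖x - x0‖ ≤ (2 + K) * RR m μ p x := by nlinarith
    have h12 : ‖x - x0‖ ≤ (2 + K) / c * RR m μ p x := by
      rw [div_mul_eq_mul_div, le_div_iff₀ hc]; linarith
    rw [hL]; linarith
  calc ∫⁻ x in S, kR m μ (d + 1) p x
      ≤ ∫⁻ x in S, ENNReal.ofReal (L ^ (d + 1)) *
        ENNReal.ofReal ((1 + ‖x - x0‖) ^ (-((d + 1 : ℕ) : ℝ))) := by
        refine setLIntegral_mono (by fun_prop) fun x hx => ?_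
        rw [kR, ← ENNReal.ofReal_mul (by positivity)]
        apply ENNReal.ofReal_le_ofReal
        have h1 := hmain x hx
        have h10 := one_le_RR m μ p x
        have h2 : (0 : ℝ) < 1 + ‖x - x0‖ := by positivity
        rw [Real.rpow_neg h2.le, Real.rpow_natCast, ← inv_pow, ← mul_pow]
        refine pow_le_pow_left₀ (by positivity) ?_ _
        rw [inv_le_iff_one_le_mul₀ (by positivity), mul_right_comm, ← div_eq_mul_inv,
          le_div_iff₀ h2]
        linarith
    _ ≤ ∫⁻ x, ENNReal.ofReal (L ^ (d + 1)) *
        ENNReal.ofReal ((1 + ‖x - x0‖) ^ (-((d + 1 : ℕ) : ℝ))) := setLIntegral_le_lintegral _ _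
    _ = _ := by
      rw [lintegral_const_mul _ (by fun_prop)]
      congr 1
      exact lintegral_sub_right_eq_self
        (fun x => ENNReal.ofReal ((1 + ‖x‖) ^ (-((d + 1 : ℕ) : ℝ)))) x0

lemma lint_bound {m : ℝ} (hm : 2 ≤ m) {μ : EV d → ℝ} (hμ : Hom m μ)
    (hhess : ∀ x : EV d, ‖x‖ = 1 → Function.Bijective ⇑(fderiv ℝ (fderiv ℝ μ) x)) :
    ∃ C : ℝ≥0∞, C < ⊤ ∧ ∀ p : EV d × EV d, ∫⁻ x in Us d, kR m μ (d + 1) p x ≤ C := by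
  let Q : Set (EV d) → Prop := fun T => ∃ C : ℝ≥0∞, C < ⊤ ∧ ∀ p : EV d × EV d,
    ∫⁻ x in Us d ∩ {x | ‖x‖⁻¹ • x ∈ T}, kR m μ (d + 1) p x ≤ C
  have hQ : Q (Metric.sphere 0 1) := by
    refine (isCompact_sphere (0 : EV d) 1).induction_on (p := Q) ?_ ?_ ?_ ?_
    · exact ⟨0, by simp, by simp⟩
    · rintro s t hst ⟨C, hC, h⟩
      refine ⟨C, hC, fun p => le_trans (lintegral_mono_set ?_) (h p)⟩
      exact fun x hx => ⟨hx.1, hst hx.2⟩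
    · rintro s t ⟨C, hC, h⟩ ⟨C', hC', h'⟩
      refine ⟨C + C', ENNReal.add_lt_top.2 ⟨hC, hC'⟩, fun p => ?_⟩
      refine le_trans (lintegral_mono_set ?_) ((lintegral_union_le _ _ _).trans
        (add_le_add (h p) (h' p)))
      rintro x ⟨hx, h1 | h1⟩
      · exact Or.inl ⟨hx, h1⟩
      · exact Or.inr ⟨hx, h1⟩
    · intro v0 hv0
      have hv0' : ‖v0‖ = 1 := by simpa using hv0
      obtain ⟨κ, hκ, c, hc, hlow⟩ := cone_lower hm hμ.1 hμ.2 hhess hv0'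
      refine ⟨Cone v0 κ, mem_nhdsWithin_of_mem_nhds ?_, ?_⟩
      · have ho : IsOpen (Cone v0 κ) := isOpen_lt (by fun_prop) (by fun_prop)
        refine ho.mem_nhds ?_
        simp [Cone, hv0', hκ]
      · refine cone_lint hm (S := Us d ∩ {x | ‖x‖⁻¹ • x ∈ Cone v0 κ}) Set.inter_subset_left hc ?_
        have hsub : ∀ x ∈ Us d ∩ {x | ‖x‖⁻¹ • x ∈ Cone v0 κ}, x ∈ Cone v0 κ := by
          rintro x ⟨hx, h1⟩
          have hn : 0 < ‖x‖ := norm_pos_iff.2 (ne_zero_of_Us hx)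
          simp only [Cone, Set.mem_ofPred_eq, norm_smul, norm_inv, norm_norm, inner_smul_left,
            conj_trivial] at h1 ⊢
          rw [inv_mul_cancel₀ hn.ne', mul_one, lt_inv_mul_iff₀ hn] at h1
          linarith
        exact fun x hx x' hx' => hlow x (hsub x hx) x' (hsub x' hx')
  obtain ⟨C, hC, h⟩ := hQ
  refine ⟨C, hC, fun p => le_trans (lintegral_mono_set ?_) (h p)⟩
  intro x hx
  have hn : 0 < ‖x‖ := norm_pos_iff.2 (ne_zero_of_Us hx)
  refine ⟨hx, ?_⟩
  simp [norm_smul, inv_mul_cancel₀ hn.ne']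

end

end Fresnel

namespace Fresnel

section

variable {d : ℕ}

def ee (t : ℝ) : ℂ := Complex.exp (((2 * Real.pi * t : ℝ) : ℂ) * Complex.I)

lemma norm_ee (t : ℝ) : ‖ee t‖ = 1 := Complex.norm_exp_ofReal_mul_I _

lemma ee_add (s t : ℝ) : ee (s + t) = ee s * ee t := by
  unfold ee
  rw [← Complex.exp_add]
  congr 1
  push_cast
  ring

lemma continuous_ee : Continuous ee := by unfold ee; fun_prop

lemma hasDerivAt_ee (t : ℝ) : HasDerivAt ee (2 * π * I * ee t) t := by
  have h1 : HasDerivAt (fun t : ℝ => (((2 * Real.pi * t : ℝ) : ℂ) * Complex.I))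
      (2 * π * I) t := by
    have := (((hasDerivAt_id t).const_mul (2 * π)).ofReal_comp).mul_const Complex.I
    simpa using this
  have h2 := h1.cexp
  unfold ee
  exact h2.congr_deriv (by ring)

/-- oscillating factor -/
def ph (μ : EV d → ℝ) (p : EV d × EV d) (x : EV d) : ℂ := ee (μ x + ⟪x, p.2⟫)

lemma norm_ph (μ : EV d → ℝ) (p : EV d × EV d) (x : EV d) : ‖ph μ p x‖ = 1 := norm_ee _

lemma inner_bv (j : Fin d) (y : EV d) : ⟪bv j, y⟫ = y j := by
  rw [bv, EuclideanSpace.inner_single_left]; simp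

lemma hasFDerivAt_ph {m : ℝ} {μ : EV d → ℝ} (hμ : Hom m μ) (p : EV d × EV d) {x : EV d}
    (hx : x ≠ 0) : DifferentiableAt ℝ (ph μ p) x ∧
      ∀ j, pd j (ph μ p) x = 2 * π * I * ((pd j μ x + p.2 j : ℝ) : ℂ) * ph μ p x := by
  have h1 : HasFDerivAt (fun x : EV d => ⟪x, p.2⟫) (innerSL ℝ p.2) x := by
    have := (innerSL ℝ p.2).hasFDerivAt (x := x)
    refine this.congr_of_eventuallyEq ?_
    filter_upwards with z
    simp [real_inner_comm]
  have h2 : HasFDerivAt (fun x : EV d => μ x + ⟪x, p.2⟫) (fderiv ℝ μ x + innerSL ℝ p.2) x :=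
    (hμ.diff hx).hasFDerivAt.add h1
  have h3 : HasFDerivAt (ph μ p) ((2 * π * I * ee (μ x + ⟪x, p.2⟫)) •
      (Complex.ofRealCLM.comp (fderiv ℝ μ x + innerSL ℝ p.2))) x := by
    have h5 := (hasDerivAt_ee (μ x + ⟪x, p.2⟫)).hasFDerivAt.comp x h2
    refine h5.congr_fderiv ?_
    ext v
    simp
    ring
  refine ⟨h3.differentiableAt, fun j => ?_⟩
  have h4 : ⟪p.2, bv j⟫ = p.2 j := by rw [real_inner_comm, inner_bv]
  simp only [pd, h3.fderiv]
  simp [h4, ph, pd]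
  ring

/-- amplitudes -/
def Amp {P : Type*} (n : ℕ) (W : P → EV d → ℝ) (a : P → EV d → ℂ) : Prop :=
  Sym W n a ∧ ∀ p x, ‖x‖ < 1 → a p x = 0

lemma pd_eq_zero {f : EV d → ℂ} (h : ∀ x, ‖x‖ < 1 → f x = 0) (j : Fin d) (x : EV d)
    (hx : ‖x‖ < 1) : pd j f x = 0 := by
  have : f =ᶠ[nhds x] fun _ => 0 := by
    filter_upwards [(isOpen_lt continuous_norm continuous_const).mem_nhds hx] with z hz
      using h z hz
  simp [pd, this.fderiv_eq]

lemma differentiable_glue {f : EV d → ℂ} (h : ∀ x, ‖x‖ < 1 → f x = 0)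
    (hd : ∀ x ∈ Us d, DifferentiableAt ℝ f x) : Differentiable ℝ f := by
  intro x
  by_cases hx : ‖x‖ < 1
  · have : f =ᶠ[nhds x] fun _ => 0 := by
      filter_upwards [(isOpen_lt continuous_norm continuous_const).mem_nhds hx] with z hz
        using h z hz
    exact this.differentiableAt_iff.2 (differentiableAt_const _)
  · refine hd x ?_
    simp only [Us, Set.mem_ofPred_eq]
    linarith

lemma glue_cases (x : EV d) : ‖x‖ < 1 ∨ x ∈ Us d := by
  by_cases hx : ‖x‖ < 1
  · exact Or.inl hx
  · right
    simp only [Us, Set.mem_ofPred_eq]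
    linarith

def TT (m : ℝ) (μ : EV d → ℝ) (a : EV d × EV d → EV d → ℂ) (p : EV d × EV d) (x : EV d) : ℂ :=
  a p x * (((qq m μ p x)⁻¹ : ℝ) : ℂ) +
    (-(2 * π * I)⁻¹) * ∑ j, pd j (fun x => a p x * ((cc m μ j p x : ℝ) : ℂ)) x

lemma amp_T {m : ℝ} (hm : 2 ≤ m) {μ : EV d → ℝ} (hμ : Hom m μ) {n : ℕ}
    {W : EV d × EV d → EV d → ℝ} (hW : ∀ p, ∀ x ∈ Us d, 0 ≤ W p x)
    {a : EV d × EV d → EV d → ℂ} (ha : Amp (n + 1) W a) :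
    Amp n (fun p x => W p x * (RR m μ p x)⁻¹) (TT m μ a) := by
  constructor
  · have h1 := ha.1.pred.mul (sym_qinv hm hμ n).ofReal
    have h1' := h1.mono (W' := fun p x => W p x * (RR m μ p x)⁻¹) 1
      (fun p x hx => by
        have := hW p x hx
        have := one_le_qq m μ p x
        positivity)
      (fun p x hx => by
        have h2 := one_le_RR m μ p x
        rw [one_mul, ← RR_mul_self]
        refine mul_le_mul_of_nonneg_left ?_ (hW p x hx)
        exact inv_anti₀ (by positivity) (by nlinarith))
    have h2 := fun j => (ha.1.mul (sym_cc hm hμ j (n + 1)).ofReal).2.2 j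
    exact h1'.add ((Sym.sum Finset.univ h2).constMul _)
  · intro p x hx
    have h0 : ∀ j, pd j (fun x => a p x * ((cc m μ j p x : ℝ) : ℂ)) x = 0 := fun j =>
      pd_eq_zero (fun x hx => by rw [ha.2 p x hx, zero_mul]) j x hx
    simp [TT, ha.2 p x hx, h0]

lemma integral_pd_eq_zero {F : EV d → ℂ} (hd : Differentiable ℝ F) (hF : Integrable F)
    (j : Fin d) (hF' : Integrable (fun x => pd j F x)) : ∫ x, pd j F x = 0 := by
  have h := integral_mul_fderiv_eq_neg_fderiv_mul_of_integrable (μ := volume) (𝕜 := ℂ) (v := bv j)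
    (f := F) (g := fun _ => (1 : ℂ)) (by simpa [pd] using hF') (by simp)
    (by simpa using hF) (fun x _ => hd x) (fun x _ => by fun_prop)
  simpa [pd] using h

lemma ibp {m : ℝ} (hm : 2 ≤ m) {μ : EV d → ℝ} (hμ : Hom m μ) {n : ℕ}
    {W B : EV d × EV d → EV d → ℝ} (hW : ∀ p, ∀ x ∈ Us d, 0 ≤ W p x)
    (hB0 : ∀ p x, 0 ≤ B p x) (hB : ∀ p, Integrable (B p))
    (hWB : ∃ K : ℝ, 0 ≤ K ∧ ∀ p, ∀ x ∈ Us d, W p x ≤ K * B p x)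
    {a : EV d × EV d → EV d → ℂ} (ha : Amp (n + 1) W a) (p : EV d × EV d) :
    ∫ x, a p x * ph μ p x = ∫ x, TT m μ a p x * ph μ p x := by
  obtain ⟨K, hK0, hK⟩ := hWB
  have hac := fun j => ha.1.mul (sym_cc hm hμ j (n + 1)).ofReal
  -- generic integrability
  have hgen : ∀ (f : EV d → ℂ) (C : ℝ), Measurable f → (∀ x, ‖x‖ < 1 → f x = 0) →
      (∀ x ∈ Us d, ‖f x‖ ≤ C * W p x) → Integrable f := by
    intro f C hf h0 hC
    refine ((hB p).const_mul (|C| * K)).mono' hf.aestronglyMeasurable ?_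
    filter_upwards with x
    have := hB0 p x
    rcases glue_cases x with hx | hx
    · rw [h0 x hx, norm_zero]; positivity
    · refine (hC x hx).trans ?_
      calc C * W p x ≤ |C| * W p x := mul_le_mul_of_nonneg_right (le_abs_self C) (hW p x hx)
        _ ≤ |C| * (K * B p x) := mul_le_mul_of_nonneg_left (hK p x hx) (abs_nonneg _)
        _ = _ := by ring
  set F : Fin d → EV d → ℂ := fun j x => a p x * ((cc m μ j p x : ℝ) : ℂ) * ph μ p x with hFdef
  have hF0 : ∀ j x, ‖x‖ < 1 → F j x = 0 := fun j x hx => by simp [hFdef, ha.2 p x hx]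
  have hFd : ∀ j, Differentiable ℝ (F j) := fun j =>
    differentiable_glue (hF0 j) fun x hx =>
      ((hac j).2.1 p x hx).mul (hasFDerivAt_ph hμ p (ne_zero_of_Us hx)).1
  have hpdF : ∀ j, ∀ x ∈ Us d, pd j (F j) x =
      pd j (fun x => a p x * ((cc m μ j p x : ℝ) : ℂ)) x * ph μ p x +
      2 * π * I * (a p x * ((ww m μ j p x * ww m μ j p x * (qq m μ p x)⁻¹ : ℝ) : ℂ)) *
        ph μ p x := by
    intro j x hx
    have hx0 := ne_zero_of_Us hx
    have h1 : pd j (F j) x = _ := pd_mul ((hac j).2.1 p x hx) (hasFDerivAt_ph hμ p hx0).1 j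
    rw [h1, (hasFDerivAt_ph hμ p hx0).2 j]
    congr 1
    simp only [cc, ww]
    push_cast
    ring
  have hRinv : ∀ x, (RR m μ p x)⁻¹ ≤ 1 := fun x => inv_le_one_of_one_le₀ (one_le_RR m μ p x)
  have hFint : ∀ j, Integrable (F j) := by
    intro j
    obtain ⟨C, hC⟩ := (hac j).bound
    refine hgen (F j) |C| (hFd j).continuous.measurable (hF0 j) fun x hx => ?_
    rw [norm_mul, norm_ph, mul_one]
    refine (hC p x hx).trans ?_
    have h1 := hW p x hx
    have h2 : 0 ≤ (RR m μ p x)⁻¹ := by have := one_le_RR m μ p x; positivity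
    calc C * (W p x * (RR m μ p x)⁻¹) ≤ |C| * (W p x * (RR m μ p x)⁻¹) :=
          mul_le_mul_of_nonneg_right (le_abs_self C) (by positivity)
      _ ≤ |C| * (W p x * 1) := by gcongr; exact hRinv x
      _ = _ := by ring
  have hFint' : ∀ j, Integrable (fun x => pd j (F j) x) := by
    intro j
    obtain ⟨C, hC⟩ := ((hac j).2.2 j).bound
    obtain ⟨C', hC'⟩ := ha.1.bound
    refine hgen _ (|C| + 2 * π * C') ?_ (fun x hx => pd_eq_zero (hF0 j) j x hx) fun x hx => ?_
    · exact measurable_fderiv_apply_const ℝ (F j) (bv j)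
    · rw [hpdF j x hx]
      refine (norm_add_le _ _).trans ?_
      have h1 := hW p x hx
      have h2 : 0 ≤ (RR m μ p x)⁻¹ := by have := one_le_RR m μ p x; positivity
      rw [norm_mul, norm_ph, mul_one, norm_mul, norm_ph, mul_one, add_mul]
      refine add_le_add ?_ ?_
      · refine (hC p x hx).trans ?_
        calc C * (W p x * (RR m μ p x)⁻¹) ≤ |C| * (W p x * (RR m μ p x)⁻¹) :=
              mul_le_mul_of_nonneg_right (le_abs_self C) (by positivity)
          _ ≤ |C| * (W p x * 1) := by gcongr; exact hRinv x
          _ = _ := by ring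
      · have hq := one_le_qq m μ p x
        have h3 : ‖((ww m μ j p x * ww m μ j p x * (qq m μ p x)⁻¹ : ℝ) : ℂ)‖ ≤ 1 := by
          rw [Complex.norm_real, Real.norm_of_nonneg (mul_nonneg (mul_self_nonneg _) (by positivity))]
          rw [← div_eq_mul_inv, div_le_one (by positivity), ← RR_mul_self]
          rw [← abs_mul_abs_self (ww m μ j p x)]
          exact mul_self_le_mul_self (abs_nonneg _) (abs_ww_le m μ j p x)
        have h4 : ‖(2 * π * I : ℂ)‖ = 2 * π := by
          simp [abs_of_pos Real.pi_pos]
        rw [norm_mul, h4, norm_mul]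
        calc 2 * π * (‖a p x‖ * ‖((ww m μ j p x * ww m μ j p x * (qq m μ p x)⁻¹ : ℝ) : ℂ)‖)
            ≤ 2 * π * (‖a p x‖ * 1) := by gcongr
          _ ≤ 2 * π * (C' * W p x) := by
            rw [mul_one]
            exact mul_le_mul_of_nonneg_left (hC' p x hx) (by positivity)
          _ = 2 * π * C' * W p x := by ring
  have haint : Integrable (fun x => a p x * ph μ p x) := by
    obtain ⟨C', hC'⟩ := ha.1.bound
    have h0 : ∀ x, ‖x‖ < 1 → a p x * ph μ p x = 0 := fun x hx => by simp [ha.2 p x hx]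
    refine hgen _ C' ?_ h0 fun x hx => ?_
    · refine (differentiable_glue h0 fun x hx => ?_).continuous.measurable
      exact (ha.1.2.1 p x hx).mul (hasFDerivAt_ph hμ p (ne_zero_of_Us hx)).1
    · rw [norm_mul, norm_ph, mul_one]
      exact hC' p x hx
  have hid : ∀ x, TT m μ a p x * ph μ p x =
      a p x * ph μ p x - (2 * π * I)⁻¹ * ∑ j, pd j (F j) x := by
    intro x
    rcases glue_cases x with hx | hx
    · have h0 : ∀ j, pd j (fun x => a p x * ((cc m μ j p x : ℝ) : ℂ)) x = 0 := fun j =>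
        pd_eq_zero (fun x hx => by rw [ha.2 p x hx, zero_mul]) j x hx
      have h1 : ∀ j, pd j (F j) x = 0 := fun j => pd_eq_zero (hF0 j) j x hx
      simp [TT, ha.2 p x hx, h0, h1]
    · have hs : ∑ j, pd j (F j) x =
          (∑ j, pd j (fun x => a p x * ((cc m μ j p x : ℝ) : ℂ)) x) * ph μ p x +
          2 * π * I * a p x * (((qq m μ p x - 1) * (qq m μ p x)⁻¹ : ℝ) : ℂ) * ph μ p x := by
        rw [Finset.sum_congr rfl fun j _ => hpdF j x hx, Finset.sum_add_distrib, Finset.sum_mul]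
        congr 1
        have : qq m μ p x - 1 = ∑ j, ww m μ j p x * ww m μ j p x := by simp [qq]
        rw [this, Finset.sum_mul]
        push_cast
        rw [Finset.mul_sum, Finset.sum_mul]
        refine Finset.sum_congr rfl fun j _ => ?_
        ring
      have hq : (qq m μ p x : ℂ) ≠ 0 := by
        have := one_le_qq m μ p x
        exact_mod_cast (by positivity : qq m μ p x ≠ 0)
      have hpi : (2 * π * I : ℂ) ≠ 0 := Complex.two_pi_I_ne_zero
      rw [hs, TT]
      set S := ∑ j, pd j (fun x => a p x * ((cc m μ j p x : ℝ) : ℂ)) x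
      have h5 : (2 * π * I : ℂ)⁻¹ * (2 * π * I) = 1 := inv_mul_cancel₀ hpi
      set i2 := (2 * π * I : ℂ)⁻¹
      have h6 : i2 * (S * ph μ p x + 2 * π * I * a p x *
          (((qq m μ p x - 1) * (qq m μ p x)⁻¹ : ℝ) : ℂ) * ph μ p x) =
          i2 * S * ph μ p x + (i2 * (2 * π * I)) * a p x *
          (((qq m μ p x - 1) * (qq m μ p x)⁻¹ : ℝ) : ℂ) * ph μ p x := by ring
      rw [h6, h5]
      push_cast
      field_simp
      ring
  simp_rw [hid]
  rw [integral_sub haint ((integrable_finsetSum _ fun j _ => hFint' j).const_mul _),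
    integral_const_mul, integral_finsetSum _ fun j _ => hFint' j]
  rw [Finset.sum_eq_zero fun j _ => integral_pd_eq_zero (hFd j) (hFint j) j (hFint' j)]
  simp

lemma osc_bound {m : ℝ} (hm : 2 ≤ m) {μ : EV d → ℝ} (hμ : Hom m μ)
    {B : EV d × EV d → EV d → ℝ} (hB0 : ∀ p x, 0 ≤ B p x) (hB : ∀ p, Integrable (B p)) (N : ℕ)
    {W : EV d × EV d → EV d → ℝ} (hW : ∀ p, ∀ x ∈ Us d, 0 ≤ W p x)
    (hWB : ∃ K : ℝ, 0 ≤ K ∧ ∀ p, ∀ x ∈ Us d, W p x ≤ K * B p x)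
    {a : EV d × EV d → EV d → ℂ} (ha : Amp N W a) :
    ∃ C : ℝ≥0∞, C < ⊤ ∧ ∀ p, ‖∫ x, a p x * ph μ p x‖ₑ ≤
      C * ∫⁻ x in Us d, ENNReal.ofReal (W p x * (RR m μ p x)⁻¹ ^ N) := by
  induction N generalizing W a with
  | zero =>
    obtain ⟨C, hC⟩ := ha.1.bound
    refine ⟨ENNReal.ofReal |C|, ENNReal.ofReal_lt_top, fun p => ?_⟩
    refine (enorm_integral_le_lintegral_enorm _).trans ?_
    rw [← lintegral_const_mul' _ _ ENNReal.ofReal_ne_top,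
      ← lintegral_indicator (isOpen_Us d).measurableSet]
    refine lintegral_mono fun x => ?_
    by_cases hx : x ∈ Us d
    · rw [Set.indicator_of_mem hx, pow_zero, mul_one, ← ENNReal.ofReal_mul (abs_nonneg _),
        ← ofReal_norm, norm_mul, norm_ph, mul_one]
      refine ENNReal.ofReal_le_ofReal ((hC p x hx).trans ?_)
      exact mul_le_mul_of_nonneg_right (le_abs_self C) (hW p x hx)
    · have : ‖x‖ < 1 := (glue_cases x).resolve_right hx
      simp [ha.2 p x this]
  | succ N ih =>
    have hR : ∀ p x, 0 ≤ (RR m μ p x)⁻¹ := fun p x => by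
      have := one_le_RR m μ p x; positivity
    obtain ⟨K, hK0, hK⟩ := id hWB
    obtain ⟨C, hC, h⟩ := ih (W := fun p x => W p x * (RR m μ p x)⁻¹)
      (fun p x hx => mul_nonneg (hW p x hx) (hR p x))
      ⟨K, hK0, fun p x hx => le_trans (mul_le_of_le_one_right (hW p x hx)
        (inv_le_one_of_one_le₀ (one_le_RR m μ p x))) (hK p x hx)⟩ (amp_T hm hμ hW ha)
    refine ⟨C, hC, fun p => ?_⟩
    rw [ibp hm hμ hW hB0 hB hWB ha p]
    refine (h p).trans_eq ?_
    congr 2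
    ext x
    rw [pow_succ']
    congr 1
    ring

end

end Fresnel

namespace Fresnel

section

variable {d : ℕ}

/-- polynomial decay weight -/
def Bw (z : EV d) : ℝ := ((1 + ‖z‖) ^ (d + 1))⁻¹

lemma Bw_pos (z : EV d) : 0 < Bw z := by unfold Bw; positivity

lemma continuous_Bw : Continuous (Bw : EV d → ℝ) := by
  unfold Bw
  refine Continuous.inv₀ (by fun_prop) fun z => ?_
  positivity

lemma integrable_Bw : Integrable (Bw : EV d → ℝ) := by
  have h := integrable_one_add_norm (E := EV d) (μ := volume) (r := (d + 1 : ℕ))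
    (by simp)
  refine h.congr ?_
  filter_upwards with z
  rw [Real.rpow_neg (by positivity), Real.rpow_natCast]
  rfl

lemma schwartz_le_Bw (G : SchwartzMap (EV d) ℂ) : ∃ C : ℝ, 0 ≤ C ∧ ∀ z, ‖G z‖ ≤ C * Bw z := by
  refine ⟨2 ^ (d + 1) * ((Finset.Iic ((d + 1, 0) : ℕ × ℕ)).sup
    (fun m => SchwartzMap.seminorm ℝ m.1 m.2)) G, by positivity, fun z => ?_⟩
  have h := SchwartzMap.one_add_le_sup_seminorm_apply (𝕜 := ℝ) (m := (d + 1, 0))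
    (k := d + 1) (n := 0) le_rfl le_rfl G z
  rw [norm_iteratedFDeriv_zero] at h
  rw [Bw, ← div_eq_mul_inv, le_div_iff₀ (by positivity), mul_comm]
  exact h

open scoped LineDeriv in
lemma sym_schwartz (G : SchwartzMap (EV d) ℂ) (n : ℕ) :
    Sym (fun (p : EV d × EV d) x => Bw (p.1 - x)) n (fun p x => G (p.1 - x)) := by
  induction n generalizing G with
  | zero =>
    obtain ⟨C, -, hC⟩ := schwartz_le_Bw G
    exact ⟨C, fun p x _ => hC _⟩
  | succ n ih =>
    obtain ⟨C, -, hC⟩ := schwartz_le_Bw G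
    have hd : ∀ (p : EV d × EV d) (x : EV d), HasFDerivAt (fun x => G (p.1 - x))
        ((fderiv ℝ G (p.1 - x)).comp (-ContinuousLinearMap.id ℝ (EV d))) x := fun p x =>
      (G.hasFDerivAt (p.1 - x)).comp x ((hasFDerivAt_id x).const_sub p.1)
    refine ⟨⟨C, fun p x _ => hC _⟩, fun p x _ => (hd p x).differentiableAt, fun j => ?_⟩
    refine (ih (-(∂_{bv j} G))).congr fun p x _ => ?_
    simp only [pd, (hd p x).fderiv]
    simp [SchwartzMap.lineDerivOp_apply_eq_fderiv]

/-- smooth cutoff -/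
def chi (d : ℕ) : ContDiffBump (0 : EV d) := ⟨1, 2, one_pos, one_lt_two⟩

lemma chi_hcs : HasCompactSupport (fun x => ((chi d x : ℝ) : ℂ)) :=
  (chi d).hasCompactSupport.comp_left (g := fun t : ℝ => (t : ℂ)) (by simp)

lemma chi_smooth : ContDiff ℝ (⊤ : ℕ∞) (fun x => ((chi d x : ℝ) : ℂ)) :=
  Complex.ofRealCLM.contDiff.comp (chi d).contDiff

def chiS (d : ℕ) : SchwartzMap (EV d) ℂ := chi_hcs.toSchwartzMap chi_smooth

lemma chiS_apply (x : EV d) : chiS d x = ((chi d x : ℝ) : ℂ) := rfl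

open scoped LineDeriv in
lemma sym_schwartz_one (G : SchwartzMap (EV d) ℂ) (n : ℕ) :
    Sym (fun (_ : EV d × EV d) _ => (1 : ℝ)) n (fun _ x => G x) := by
  induction n generalizing G with
  | zero =>
    exact ⟨SchwartzMap.seminorm ℝ 0 0 G, fun p x _ => by
      rw [mul_one]; exact SchwartzMap.norm_le_seminorm ℝ G x⟩
  | succ n ih =>
    refine ⟨⟨SchwartzMap.seminorm ℝ 0 0 G, fun p x _ => by
      rw [mul_one]; exact SchwartzMap.norm_le_seminorm ℝ G x⟩,
      fun p x _ => G.differentiableAt, fun j => ?_⟩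
    refine (ih (∂_{bv j} G)).congr fun p x _ => ?_
    simp [pd, SchwartzMap.lineDerivOp_apply_eq_fderiv]

lemma amp_high (G : SchwartzMap (EV d) ℂ) (n : ℕ) :
    Amp n (fun (p : EV d × EV d) x => Bw (p.1 - x))
      (fun p x => G (p.1 - x) * (1 - chiS d x)) := by
  constructor
  · have h1 : Sym (fun (_ : EV d × EV d) _ => (1 : ℝ)) n
        (fun (_ : EV d × EV d) (x : EV d) => (1 : ℂ) + (-chiS d) x) :=
      (Sym.const (1 : ℂ)).add (sym_schwartz_one _ n)
    have h2 := (sym_schwartz G n).mul h1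
    refine (h2.mono (W' := fun (p : EV d × EV d) x => Bw (p.1 - x)) 1 (fun p x _ => ?_)
      (fun p x _ => ?_)).congr fun p x _ => ?_
    · have := Bw_pos (p.1 - x); positivity
    · simp
    · simp [sub_eq_add_neg]
  · intro p x hx
    have : chi d x = 1 := (chi d).one_of_mem_closedBall (by
      rw [mem_closedBall_zero_iff]; exact hx.le)
    simp [chiS_apply, this]

def kk (m : ℝ) (μ : EV d → ℝ) (y x : EV d) : ℝ≥0∞ :=
  ‖chiS d x‖ₑ + (Us d).indicator (kR m μ (d + 1) (0, y)) x

def UU (F : EV d → ℂ) (G : EV d → ℂ) (y ξ : EV d) : ℂ :=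
  ∫ η, G (ξ - η) * (F η * ee ⟪η, y⟫)

lemma measurable_kR (m : ℝ) (μ : EV d → ℝ) (N : ℕ) (p : EV d × EV d) :
    Measurable (kR m μ N p) := by
  have h1 : ∀ j, Measurable (fun x => ww m μ j p x) := fun j => by
    unfold ww rho
    exact ((measurable_fderiv_apply_const ℝ μ (bv j)).add_const _).mul
      (measurable_norm.pow_const _)
  have h2 : Measurable (fun x => RR m μ p x) := by
    unfold RR qq
    exact (measurable_const.add (Finset.measurable_fun_sum _ fun j _ => (h1 j).mul (h1 j))).sqrt
  exact (h2.inv.pow_const N).ennreal_ofReal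

lemma measurable_kk (m : ℝ) (μ : EV d → ℝ) (y : EV d) : Measurable (kk m μ y) :=
  (chiS d).continuous.measurable.enorm.add
    ((measurable_kR m μ _ _).indicator (isOpen_Us d).measurableSet)

lemma kk_bound {m : ℝ} (hm : 2 ≤ m) {μ : EV d → ℝ} (hμ : Hom m μ)
    (hhess : ∀ x : EV d, ‖x‖ = 1 → Function.Bijective ⇑(fderiv ℝ (fderiv ℝ μ) x)) :
    ∃ C : ℝ≥0∞, C < ⊤ ∧ ∀ y, ∫⁻ x, kk m μ y x ≤ C := by
  obtain ⟨C, hC, h⟩ := lint_bound hm hμ hhess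
  refine ⟨(∫⁻ x, ‖chiS d x‖ₑ) + C, ?_, fun y => ?_⟩
  · exact ENNReal.add_lt_top.2 ⟨((chiS d).integrable (μ := volume)).2, hC⟩
  · unfold kk
    rw [lintegral_add_left (chiS d).continuous.measurable.enorm,
      lintegral_indicator (isOpen_Us d).measurableSet]
    gcongr
    exact h _

lemma kk_local {m : ℝ} (hm : 2 ≤ m) (μ : EV d → ℝ) :
    ∃ C : ℝ≥0∞, C < ⊤ ∧ ∀ y y0 x : EV d, ‖y - y0‖ ≤ 1 → kk m μ y x ≤ C * kk m μ y0 x := by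
  set r : ℝ := (1 / 2) ^ (2 - m) with hr
  have hr0 : 0 ≤ r := by positivity
  set Lc : ℝ := √(2 + 2 * r ^ 2) with hLc
  have hLc1 : 1 ≤ Lc := by
    rw [hLc, Real.one_le_sqrt]; nlinarith [sq_nonneg r]
  have hRR : ∀ y y0 x : EV d, x ∈ Us d → ‖y - y0‖ ≤ 1 →
      RR m μ (0, y0) x ≤ Lc * RR m μ (0, y) x := by
    intro y y0 x hx hy
    rw [hLc, RR, RR, ← Real.sqrt_mul (by positivity)]
    refine Real.sqrt_le_sqrt ?_
    have hρ := rho_le hm hx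
    have hρ0 : 0 ≤ rho m x := Real.rpow_nonneg (norm_nonneg _) _
    have hw : ∀ j, ww m μ j (0, y0) x * ww m μ j (0, y0) x ≤
        2 * (ww m μ j (0, y) x * ww m μ j (0, y) x) + 2 * r ^ 2 * ((y - y0) j) ^ 2 := by
      intro j
      have e : ww m μ j (0, y0) x = ww m μ j (0, y) x - (y - y0) j * rho m x := by
        simp only [ww, PiLp.sub_apply]; ring
      have h1 : ((y - y0) j * rho m x) ^ 2 ≤ r ^ 2 * ((y - y0) j) ^ 2 := by
        rw [mul_pow, mul_comm]
        gcongr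
      rw [e]
      nlinarith [sq_nonneg (ww m μ j (0, y) x + (y - y0) j * rho m x)]
    have hs : ∑ j, ((y - y0) j) ^ 2 ≤ 1 := by
      rw [← EuclideanSpace.real_norm_sq_eq]
      nlinarith [norm_nonneg (y - y0)]
    have hsum := Finset.sum_le_sum fun j (_ : j ∈ Finset.univ) => hw j
    rw [Finset.sum_add_distrib, ← Finset.mul_sum, ← Finset.mul_sum] at hsum
    have hS : 0 ≤ ∑ j, ww m μ j (0, y) x * ww m μ j (0, y) x :=
      Finset.sum_nonneg fun j _ => mul_self_nonneg _
    simp only [qq]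
    nlinarith [mul_le_mul_of_nonneg_left hs (by positivity : 0 ≤ 2 * r ^ 2),
      mul_nonneg (by positivity : 0 ≤ 2 * r ^ 2) hS]
  refine ⟨ENNReal.ofReal (Lc ^ (d + 1)), ENNReal.ofReal_lt_top, fun y y0 x hy => ?_⟩
  have hone : 1 ≤ ENNReal.ofReal (Lc ^ (d + 1)) := by
    rw [ENNReal.one_le_ofReal]; exact one_le_pow₀ hLc1
  unfold kk
  rw [mul_add]
  refine add_le_add (le_mul_of_one_le_left zero_le hone) ?_
  by_cases hx : x ∈ Us d
  · rw [Set.indicator_of_mem hx, Set.indicator_of_mem hx, kR, kR,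
      ← ENNReal.ofReal_mul (by positivity), ← mul_pow]
    have h1 := one_le_RR m μ (0, y) x
    have h2 := one_le_RR m μ (0, y0) x
    refine ENNReal.ofReal_le_ofReal (pow_le_pow_left₀ (by positivity) ?_ _)
    rw [← div_eq_mul_inv, le_div_iff₀ (by positivity), inv_mul_le_iff₀ (by positivity), mul_comm]
    exact hRR y y0 x hx hy
  · simp [hx]

lemma key_bound {m : ℝ} (hm : 2 ≤ m) {μ : EV d → ℝ} (hμ : Hom m μ) {F : EV d → ℂ}
    (hFm : Measurable F)
    (hF : ∀ x, x ≠ 0 → F x = ee (μ x)) (hF1 : ∀ x, ‖F x‖ = 1) (G : SchwartzMap (EV d) ℂ) :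
    ∃ C : ℝ≥0∞, C < ⊤ ∧ ∀ y ξ, ‖UU F G y ξ‖ₑ ≤
      C * ∫⁻ η, ENNReal.ofReal (Bw (ξ - η)) * kk m μ y η := by
  obtain ⟨C1, hC1, h1⟩ := osc_bound hm hμ (B := fun p x => Bw (p.1 - x))
    (fun p x => (Bw_pos _).le) (fun p => integrable_Bw.comp_sub_left p.1) (d + 1)
    (fun p x _ => (Bw_pos _).le) ⟨1, zero_le_one, fun p x _ => by rw [one_mul]⟩
    (amp_high G (d + 1))
  obtain ⟨C2, hC20, hC2⟩ := schwartz_le_Bw G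
  refine ⟨C1 + ENNReal.ofReal C2, ENNReal.add_lt_top.2 ⟨hC1, ENNReal.ofReal_lt_top⟩,
    fun y ξ => ?_⟩
  have hmeas : Measurable (fun η => F η * ee ⟪η, y⟫) :=
    hFm.mul (continuous_ee.comp (by fun_prop)).measurable
  have hn : ∀ η, ‖F η * ee ⟪η, y⟫‖ = 1 := fun η => by rw [norm_mul, hF1, norm_ee, mul_one]
  have hGi : Integrable (fun η => G (ξ - η) * (F η * ee ⟪η, y⟫)) :=
    ((G.integrable (μ := volume)).comp_sub_left ξ).mul_bdd (c := 1)
      hmeas.aestronglyMeasurable (by filter_upwards with η using (hn η).le)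
  have hsplit : UU F G y ξ = (∫ η, G (ξ - η) * (1 - chiS d η) * ph μ (ξ, y) η) +
      ∫ η, chiS d η * (G (ξ - η) * (F η * ee ⟪η, y⟫)) := by
    have e : ∀ η, G (ξ - η) * (1 - chiS d η) * ph μ (ξ, y) η =
        (1 - chiS d η) * (G (ξ - η) * (F η * ee ⟪η, y⟫)) := by
      intro η
      by_cases h0 : η = 0
      · have := (amp_high G 0).2 (ξ, y) η (by simp [h0])
        simp only at this
        rw [this, zero_mul]
        rw [show (1 - chiS d η) * (G (ξ - η) * (F η * ee ⟪η, y⟫)) =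
          (G (ξ - η) * (1 - chiS d η)) * (F η * ee ⟪η, y⟫) by ring, this, zero_mul]
      · rw [hF η h0, ← ee_add, ph]; ring
    have hci : Integrable (fun η => chiS d η * (G (ξ - η) * (F η * ee ⟪η, y⟫))) := by
      refine hGi.bdd_mul (c := SchwartzMap.seminorm ℝ 0 0 (chiS d))
        (chiS d).continuous.aestronglyMeasurable ?_
      filter_upwards with η using SchwartzMap.norm_le_seminorm ℝ _ _
    simp_rw [e]
    have hci' : Integrable (fun η => (1 - chiS d η) * (G (ξ - η) * (F η * ee ⟪η, y⟫))) := by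
      refine (hGi.sub hci).congr ?_
      filter_upwards with η
      simp only [Pi.sub_apply]; ring
    rw [← integral_add hci' hci, UU]
    congr 1
    ext η
    ring
  rw [hsplit]
  refine (enorm_add_le _ _).trans ?_
  rw [add_mul]
  refine add_le_add ((h1 (ξ, y)).trans ?_) ?_
  · refine mul_le_mul' le_rfl ?_
    rw [← lintegral_indicator (isOpen_Us d).measurableSet]
    refine lintegral_mono fun η => ?_
    by_cases hx : η ∈ Us d
    · simp only [Set.indicator_of_mem hx, kk]
      rw [ENNReal.ofReal_mul (Bw_pos _).le]
      gcongr
      exact le_add_self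
    · simp [hx]
  · rw [← lintegral_const_mul' _ _ ENNReal.ofReal_ne_top]
    refine (enorm_integral_le_lintegral_enorm _).trans (lintegral_mono fun η => ?_)
    rw [enorm_mul, enorm_mul, mul_comm, ← mul_assoc]
    have e1 : ‖F η * ee ⟪η, y⟫‖ₑ = 1 := by
      rw [← ofReal_norm, hn, ENNReal.ofReal_one]
    rw [e1, mul_one, ← ENNReal.ofReal_mul hC20]
    refine mul_le_mul' ?_ le_self_add
    rw [← ofReal_norm]
    exact ENNReal.ofReal_le_ofReal (hC2 _)

/-- Tonelli for the dominating function -/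
lemma lint_conv (k : EV d → ℝ≥0∞) (hk : Measurable k) :
    ∫⁻ ξ, ∫⁻ η, ENNReal.ofReal (Bw (ξ - η)) * k η =
      (∫⁻ z : EV d, ENNReal.ofReal (Bw z)) * ∫⁻ η, k η := by
  rw [lintegral_lintegral_swap]
  · rw [← lintegral_const_mul _ hk]
    refine lintegral_congr fun η => ?_
    rw [lintegral_mul_const _ (by
      exact (continuous_Bw.comp (by fun_prop)).measurable.ennreal_ofReal)]
    rw [lintegral_sub_right_eq_self (fun z : EV d => ENNReal.ofReal (Bw z)) η]
  · refine Measurable.aemeasurable ?_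
    exact ((continuous_Bw.comp (by fun_prop)).measurable.ennreal_ofReal).mul
      (hk.comp measurable_snd)

end

end Fresnel

namespace Fresnel

section

variable {d : ℕ}

lemma measurable_integrand {F : EV d → ℂ} (hFm : Measurable F) (G : SchwartzMap (EV d) ℂ) :
    StronglyMeasurable (fun q : (EV d × EV d) × EV d =>
      G (q.1.2 - q.2) * (F q.2 * ee ⟪q.2, q.1.1⟫)) := by
  refine Measurable.stronglyMeasurable ?_
  refine Measurable.mul (G.continuous.comp (by fun_prop)).measurable ?_
  exact (hFm.comp measurable_snd).mul (continuous_ee.comp (by fun_prop)).measurable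

lemma measurable_UU {F : EV d → ℂ} (hFm : Measurable F) (G : SchwartzMap (EV d) ℂ) :
    StronglyMeasurable (fun q : EV d × EV d => UU F G q.1 q.2) :=
  (measurable_integrand hFm G).integral_prod_right'

lemma measurable_UU_right {F : EV d → ℂ} (hFm : Measurable F) (G : SchwartzMap (EV d) ℂ)
    (y : EV d) : StronglyMeasurable (fun ξ => UU F G y ξ) :=
  (measurable_UU hFm G).comp_measurable measurable_prodMk_left

lemma continuous_UU {F : EV d → ℂ} (hFm : Measurable F) (hF1 : ∀ x, ‖F x‖ = 1)
    (G : SchwartzMap (EV d) ℂ) (ξ : EV d) : Continuous (fun y => UU F G y ξ) := by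
  unfold UU
  refine continuous_of_dominated (bound := fun η => ‖G (ξ - η)‖) (fun y => ?_) (fun y => ?_)
    ((G.integrable (μ := volume)).comp_sub_left ξ).norm ?_
  · exact ((measurable_integrand hFm G).comp_measurable
      (measurable_prodMk_left (x := (y, ξ)))).aestronglyMeasurable
  · filter_upwards with η
    rw [norm_mul, norm_mul, hF1, norm_ee, mul_one, mul_one]
  · filter_upwards with η
    refine continuous_const.mul (continuous_const.mul (continuous_ee.comp ?_))
    fun_prop

lemma UU_lint {m : ℝ} (hm : 2 ≤ m) {μ : EV d → ℝ} (hμ : Hom m μ)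
    (hhess : ∀ x : EV d, ‖x‖ = 1 → Function.Bijective ⇑(fderiv ℝ (fderiv ℝ μ) x))
    {F : EV d → ℂ} (hFm : Measurable F)
    (hF : ∀ x, x ≠ 0 → F x = ee (μ x)) (hF1 : ∀ x, ‖F x‖ = 1) (G : SchwartzMap (EV d) ℂ) :
    (∃ C : ℝ≥0∞, C < ⊤ ∧ ∀ y, ∫⁻ ξ, ‖UU F G y ξ‖ₑ ≤ C) ∧
    ∀ y0, ∃ b : EV d → ℝ, Integrable b ∧ ∀ y, ‖y - y0‖ ≤ 1 → ∀ᵐ ξ, ‖UU F G y ξ‖ ≤ b ξ := by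
  obtain ⟨C1, hC1, h1⟩ := key_bound hm hμ hFm hF hF1 G
  obtain ⟨C2, hC2, h2⟩ := kk_bound hm hμ hhess
  obtain ⟨C3, hC3, h3⟩ := kk_local hm μ
  set J := ∫⁻ z : EV d, ENNReal.ofReal (Bw z) with hJdef
  have hJ : J < ⊤ := by
    have h := (integrable_Bw (d := d)).2
    rw [hasFiniteIntegral_iff_ofReal (by filter_upwards with z using (Bw_pos z).le)] at h
    exact h
  have hconv : ∀ y, ∫⁻ ξ, ∫⁻ η, ENNReal.ofReal (Bw (ξ - η)) * kk m μ y η ≤ J * C2 := by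
    intro y
    rw [lint_conv _ (measurable_kk m μ y)]
    gcongr
    exact h2 y
  have hmeasc : ∀ y, Measurable fun ξ => ∫⁻ η, ENNReal.ofReal (Bw (ξ - η)) * kk m μ y η := by
    intro y
    refine Measurable.lintegral_prod_right' (f := fun q : EV d × EV d =>
      ENNReal.ofReal (Bw (q.1 - q.2)) * kk m μ y q.2) ?_
    exact ((continuous_Bw.comp (by fun_prop)).measurable.ennreal_ofReal).mul
      ((measurable_kk m μ y).comp measurable_snd)
  constructor
  · refine ⟨C1 * (J * C2), ENNReal.mul_lt_top hC1 (ENNReal.mul_lt_top hJ hC2), fun y => ?_⟩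
    refine (lintegral_mono (h1 y)).trans ?_
    rw [lintegral_const_mul' _ _ hC1.ne]
    exact mul_le_mul' le_rfl (hconv y)
  · intro y0
    set bE : EV d → ℝ≥0∞ := fun ξ =>
      C1 * (C3 * ∫⁻ η, ENNReal.ofReal (Bw (ξ - η)) * kk m μ y0 η) with hbE
    have hbm : Measurable bE := ((hmeasc y0).const_mul _).const_mul _
    have hbfin : ∫⁻ ξ, bE ξ ≠ ⊤ := by
      rw [hbE, lintegral_const_mul' _ _ hC1.ne, lintegral_const_mul' _ _ hC3.ne]
      refine (ENNReal.mul_lt_top hC1 (ENNReal.mul_lt_top hC3 ?_)).ne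
      exact (hconv y0).trans_lt (ENNReal.mul_lt_top hJ hC2)
    refine ⟨fun ξ => (bE ξ).toReal, integrable_toReal_of_lintegral_ne_top hbm.aemeasurable hbfin,
      fun y hy => ?_⟩
    filter_upwards [ae_lt_top hbm hbfin] with ξ hξ
    have h4 : ‖UU F G y ξ‖ₑ ≤ bE ξ := by
      refine (h1 y ξ).trans (mul_le_mul' le_rfl ?_)
      rw [← lintegral_const_mul' _ _ hC3.ne]
      refine lintegral_mono fun η => ?_
      calc _ ≤ ENNReal.ofReal (Bw (ξ - η)) * (C3 * kk m μ y0 η) :=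
            mul_le_mul' le_rfl (h3 y y0 η hy)
        _ = _ := by ring
    rw [← toReal_enorm]
    exact ENNReal.toReal_mono hξ.ne h4

def EE (F : EV d → ℂ) (G : EV d → ℂ) (y : EV d) : ℂ := ∫ ξ, UU F G y ξ

lemma EE_continuous {F : EV d → ℂ} (hFm : Measurable F) (hF1 : ∀ x, ‖F x‖ = 1)
    (G : SchwartzMap (EV d) ℂ)
    (hloc : ∀ y0, ∃ b : EV d → ℝ, Integrable b ∧
      ∀ y, ‖y - y0‖ ≤ 1 → ∀ᵐ ξ, ‖UU F G y ξ‖ ≤ b ξ) : Continuous (EE F G) := by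
  refine continuous_iff_continuousAt.2 fun y0 => ?_
  obtain ⟨b, hb, h⟩ := hloc y0
  refine continuousAt_of_dominated (bound := b) ?_ ?_ hb ?_
  · filter_upwards with y using (measurable_UU_right hFm G y).aestronglyMeasurable
  · filter_upwards [Metric.closedBall_mem_nhds y0 one_pos] with y hy
    exact h y (by rwa [mem_closedBall_iff_norm] at hy)
  · filter_upwards with ξ using (continuous_UU hFm hF1 G ξ).continuousAt

lemma EE_bound {F : EV d → ℂ} (G : SchwartzMap (EV d) ℂ) {C : ℝ≥0∞} (hC : C < ⊤)
    (h : ∀ y, ∫⁻ ξ, ‖UU F G y ξ‖ₑ ≤ C) (y : EV d) : ‖EE F G y‖ ≤ C.toReal := by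
  rw [← toReal_enorm]
  exact ENNReal.toReal_mono hC.ne ((enorm_integral_le_lintegral_enorm _).trans (h y))

lemma EE_identity {F : EV d → ℂ} (hFm : Measurable F) (hF1 : ∀ x, ‖F x‖ = 1)
    (G : SchwartzMap (EV d) ℂ) (hG : ∫ x, G x = 1) {C : ℝ≥0∞} (hC : C < ⊤)
    (h : ∀ y, ∫⁻ ξ, ‖UU F G y ξ‖ₑ ≤ C) {φ : EV d → ℂ} (hφ : Integrable φ)
    (hψ : Integrable (fun η : EV d => ∫ x, ee ⟪η, x⟫ * φ x)) :
    ∫ x, EE F G x * φ x = ∫ η, F η * ∫ x, ee ⟪η, x⟫ * φ x := by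
  -- step 1
  have i1 : Integrable (fun q : EV d × EV d => UU F G q.1 q.2 * φ q.1)
      (volume.prod volume) := by
    have hm1 : AEStronglyMeasurable (fun q : EV d × EV d => UU F G q.1 q.2 * φ q.1)
        (volume.prod volume) :=
      (measurable_UU hFm G).aestronglyMeasurable.mul hφ.aestronglyMeasurable.comp_fst
    refine ⟨hm1, ?_⟩
    rw [hasFiniteIntegral_iff_enorm, lintegral_prod _ hm1.enorm]
    refine lt_of_le_of_lt (b := ∫⁻ x, C * ‖φ x‖ₑ) (lintegral_mono fun x => ?_) ?_
    · simp only [enorm_mul]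
      rw [lintegral_mul_const' _ _ enorm_ne_top]
      exact mul_le_mul' (h x) le_rfl
    · rw [lintegral_const_mul' _ _ hC.ne]
      exact ENNReal.mul_lt_top hC hφ.2
  have s1 : ∫ x, EE F G x * φ x = ∫ ξ, ∫ x, UU F G x ξ * φ x := by
    rw [← integral_integral_swap i1]
    refine integral_congr_ae ?_
    filter_upwards with x
    rw [integral_mul_const]
    rfl
  -- step 2
  have s2 : ∀ ξ, ∫ x, UU F G x ξ * φ x =
      ∫ η, (F η * ∫ x, ee ⟪η, x⟫ * φ x) * G (ξ - η) := by
    intro ξ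
    have i2 : Integrable (fun q : EV d × EV d =>
        φ q.1 * G (ξ - q.2) * (F q.2 * ee ⟪q.2, q.1⟫)) (volume.prod volume) := by
      refine (hφ.mul_prod ((G.integrable (μ := volume)).comp_sub_left ξ)).mul_bdd (c := 1) ?_ ?_
      · exact ((hFm.comp measurable_snd).mul
          (continuous_ee.comp (by fun_prop)).measurable).aestronglyMeasurable
      · filter_upwards with q
        rw [norm_mul, hF1, norm_ee, mul_one]
    have e1 : ∀ x, UU F G x ξ * φ x =
        ∫ η, φ x * G (ξ - η) * (F η * ee ⟪η, x⟫) := by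
      intro x
      rw [UU, ← integral_mul_const]
      congr 1
      ext η
      ring
    simp_rw [e1]
    rw [integral_integral_swap i2]
    congr 1
    ext η
    rw [← integral_const_mul, ← integral_mul_const]
    congr 1
    ext x
    ring
  -- step 3
  have hFψ : Integrable (fun η => F η * ∫ x, ee ⟪η, x⟫ * φ x) :=
    hψ.bdd_mul (c := 1) hFm.aestronglyMeasurable (by filter_upwards with x using (hF1 x).le)
  have i3 : Integrable (fun q : EV d × EV d =>
      (F q.2 * ∫ x, ee ⟪q.2, x⟫ * φ x) * G (q.1 - q.2)) (volume.prod volume) :=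
    hFψ.convolution_integrand (ContinuousLinearMap.mul ℝ ℂ) (G.integrable (μ := volume))
  rw [s1]
  simp_rw [s2]
  rw [integral_integral_swap i3]
  refine integral_congr_ae ?_
  filter_upwards with η
  rw [integral_const_mul, integral_sub_right_eq_self (fun x => G x) η, hG, mul_one]

lemma exists_G (d : ℕ) : ∃ G : SchwartzMap (EV d) ℂ, ∫ x, G x = 1 := by
  have h : (∫ x, chiS d x) ≠ 0 := by
    have h1 : (∫ x, chiS d x) = ((∫ x, chi d x : ℝ) : ℂ) := integral_ofReal
    rw [h1]
    exact_mod_cast (chi d).integral_pos.ne'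
  refine ⟨(∫ x, chiS d x)⁻¹ • chiS d, ?_⟩
  simp only [SchwartzMap.smul_apply, smul_eq_mul]
  rw [integral_const_mul, inv_mul_cancel₀ h]

open scoped FourierTransform in
lemma fourierInv_ee (φ : SchwartzMap (EV d) ℂ) (η : EV d) :
    (𝓕⁻ φ : SchwartzMap (EV d) ℂ) η = ∫ x, ee ⟪η, x⟫ * φ x := by
  rw [SchwartzMap.fourierInv_coe, Real.fourierInv_eq']
  congr 1
  ext x
  rw [smul_eq_mul, real_inner_comm]
  rfl

open scoped FourierTransform in
lemma fourier_ee (φ : SchwartzMap (EV d) ℂ) (η : EV d) :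
    (𝓕 φ : SchwartzMap (EV d) ℂ) η = ∫ x, ee (-⟪η, x⟫) * φ x := by
  rw [SchwartzMap.fourier_coe, Real.fourier_eq']
  congr 1
  ext x
  rw [smul_eq_mul, real_inner_comm, ee]
  congr 4
  ring

open scoped FourierTransform in
lemma modulated (g : SchwartzMap (EV d) ℂ) (y ξ η : EV d) :
    ∫ x, ee ⟪η, x⟫ * (ee (-⟪ξ, x⟫) * g (x - y)) =
      ee ⟪η - ξ, y⟫ * (𝓕 g : SchwartzMap (EV d) ℂ) (ξ - η) := by
  rw [fourier_ee, ← integral_const_mul,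
    ← integral_sub_right_eq_self (fun x => ee ⟪η - ξ, y⟫ * (ee (-⟪ξ - η, x⟫) * g x)) y]
  congr 1
  ext x
  rw [← mul_assoc, ← mul_assoc, ← ee_add, ← ee_add]
  congr 2
  simp only [inner_sub_left, inner_sub_right]
  ring

lemma unique_aux {E E' : EV d → ℂ} (hE : Continuous E) (hE' : Continuous E')
    (hb : ∃ M : ℝ, ∀ x, ‖E x‖ ≤ M) (hb' : ∃ M : ℝ, ∀ x, ‖E' x‖ ≤ M)
    (h : ∀ φ : SchwartzMap (EV d) ℂ, ∫ x, E' x * φ x = ∫ x, E x * φ x) : E' = E := by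
  obtain ⟨M, hM⟩ := hb
  obtain ⟨M', hM'⟩ := hb'
  rw [← hE'.ae_eq_iff_eq volume hE]
  have h0 : ∀ᵐ x, E' x - E x = 0 := by
    refine ae_eq_zero_of_integral_contDiff_smul_eq_zero (f := fun x => E' x - E x)
      (hE'.sub hE).locallyIntegrable fun g hg hgs => ?_
    have hcs : HasCompactSupport (fun x => ((g x : ℝ) : ℂ)) :=
      hgs.comp_left (g := fun t : ℝ => (t : ℂ)) (by simp)
    have hsm : ContDiff ℝ (⊤ : ℕ∞) (fun x => ((g x : ℝ) : ℂ)) :=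
      Complex.ofRealCLM.contDiff.comp hg
    have h1 := h (hcs.toSchwartzMap hsm)
    have hi := ((hcs.toSchwartzMap hsm).integrable (μ := (volume : Measure (EV d))))
    have i1 := hi.bdd_mul (c := M) hE.aestronglyMeasurable (by filter_upwards with x using hM x)
    have i2 := hi.bdd_mul (c := M') hE'.aestronglyMeasurable
      (by filter_upwards with x using hM' x)
    rw [← sub_eq_zero, ← integral_sub i2 i1] at h1
    rw [← h1]
    congr 1
    ext x
    rw [Complex.real_smul]
    change _ = E' x * ((g x : ℝ) : ℂ) - E x * ((g x : ℝ) : ℂ)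
    ring
  filter_upwards [h0] with x hx using sub_eq_zero.1 hx


open scoped FourierTransform in
theorem main_result (d : ℕ) (hd : 1 ≤ d) (m : ℝ) (hm : 2 ≤ m)
    (μ : EuclideanSpace ℝ (Fin d) → ℝ)
    (hsmooth : ContDiffOn ℝ (⊤ : ℕ∞) μ {x | x ≠ 0})
    (hhom : ∀ c : ℝ, 0 < c → ∀ x : EuclideanSpace ℝ (Fin d), x ≠ 0 →
      μ (c • x) = c ^ m * μ x)
    (hhess : ∀ x : EuclideanSpace ℝ (Fin d), ‖x‖ = 1 →
      Function.Bijective ⇑(fderiv ℝ (fderiv ℝ μ) x))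
    (Fμ : EuclideanSpace ℝ (Fin d) → ℂ)
    (hFμ : ∀ y : EuclideanSpace ℝ (Fin d), y ≠ 0 →
      Fμ y = Complex.exp (((2 * Real.pi * μ y : ℝ) : ℂ) * Complex.I))
    (hFμ0 : Fμ 0 = 1) :
    ∃ Eμ : EuclideanSpace ℝ (Fin d) → ℂ,
      (Continuous Eμ ∧ (∃ M : ℝ, ∀ x, ‖Eμ x‖ ≤ M) ∧
        ∀ φ : SchwartzMap (EuclideanSpace ℝ (Fin d)) ℂ,
          ∫ x, Eμ x * φ x =
            ∫ ξ, Fμ ξ *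
              ∫ x, Complex.exp (((2 * Real.pi * ⟪ξ, x⟫ : ℝ) : ℂ) * Complex.I) * φ x) ∧
      (∀ Eμ' : EuclideanSpace ℝ (Fin d) → ℂ,
        Continuous Eμ' → (∃ M : ℝ, ∀ x, ‖Eμ' x‖ ≤ M) →
        (∀ φ : SchwartzMap (EuclideanSpace ℝ (Fin d)) ℂ,
          ∫ x, Eμ' x * φ x =
            ∫ ξ, Fμ ξ *
              ∫ x, Complex.exp (((2 * Real.pi * ⟪ξ, x⟫ : ℝ) : ℂ) * Complex.I) * φ x) →
        Eμ' = Eμ) ∧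
      (∀ g : SchwartzMap (EuclideanSpace ℝ (Fin d)) ℂ,
        (⨆ y : EuclideanSpace ℝ (Fin d),
          ∫⁻ ξ : EuclideanSpace ℝ (Fin d),
            (‖∫ (x : EuclideanSpace ℝ (Fin d)),
                Complex.exp (-(((2 * Real.pi * ⟪ξ, x⟫ : ℝ) : ℂ) * Complex.I)) *
                  g (x - y) * Eμ x‖₊ : ℝ≥0∞) ∂volume) < ⊤) := by
  have hμ : Hom m μ := ⟨hsmooth, hhom⟩
  have hF : ∀ x, x ≠ 0 → Fμ x = ee (μ x) := hFμ
  have hF1 : ∀ x, ‖Fμ x‖ = 1 := by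
    intro x
    by_cases hx : x = 0
    · rw [hx, hFμ0, norm_one]
    · rw [hF x hx, norm_ee]
  have hFm : Measurable Fμ := by
    refine measurable_of_continuousOn_compl_singleton 0 ?_
    refine ContinuousOn.congr (f := fun x => ee (μ x)) ?_ fun x hx => hF x hx
    exact continuous_ee.comp_continuousOn hsmooth.continuousOn
  obtain ⟨G, hG⟩ := exists_G d
  obtain ⟨⟨C, hC, hCb⟩, hloc⟩ := UU_lint hm hμ hhess hFm hF hF1 G
  have hid : ∀ φ : SchwartzMap (EuclideanSpace ℝ (Fin d)) ℂ,
      ∫ x, EE Fμ G x * φ x =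
        ∫ ξ, Fμ ξ *
          ∫ x, Complex.exp (((2 * Real.pi * ⟪ξ, x⟫ : ℝ) : ℂ) * Complex.I) * φ x := by
    intro φ
    refine EE_identity hFm hF1 G hG hC hCb (φ.integrable (μ := volume)) ?_
    refine ((𝓕⁻ φ : SchwartzMap (EV d) ℂ).integrable (μ := volume)).congr ?_
    filter_upwards with η using fourierInv_ee φ η
  have hcont := EE_continuous hFm hF1 G hloc
  have hbd : ∃ M : ℝ, ∀ x, ‖EE Fμ G x‖ ≤ M := ⟨C.toReal, EE_bound G hC hCb⟩
  refine ⟨EE Fμ G, ⟨hcont, hbd, hid⟩, fun E' hE' hb' h' => ?_, fun g => ?_⟩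
  · exact unique_aux hcont hE' hbd hb' fun φ => (h' φ).trans (hid φ).symm
  · obtain ⟨⟨C', hC', hCb'⟩, -⟩ := UU_lint hm hμ hhess hFm hF hF1 (𝓕 g)
    refine lt_of_le_of_lt (iSup_le fun y => ?_) hC'
    refine le_trans (le_of_eq ?_) (hCb' y)
    refine lintegral_congr fun ξ => ?_
    have e1 : ∫ x, Complex.exp (-(((2 * Real.pi * ⟪ξ, x⟫ : ℝ) : ℂ) * Complex.I)) *
        g (x - y) * EE Fμ G x = ∫ x, EE Fμ G x * (ee (-⟪ξ, x⟫) * g (x - y)) := by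
      congr 1
      ext x
      rw [mul_comm]
      congr 2
      unfold ee
      congr 1
      push_cast
      ring
    have hφ : Integrable (fun x => ee (-⟪ξ, x⟫) * g (x - y)) := by
      refine ((g.integrable (μ := volume)).comp_sub_right y).bdd_mul (c := 1)
        (continuous_ee.comp (by fun_prop)).aestronglyMeasurable ?_
      filter_upwards with x using (norm_ee _).le
    have hψ : Integrable (fun η : EV d => ∫ x, ee ⟪η, x⟫ * (ee (-⟪ξ, x⟫) * g (x - y))) := by
      simp_rw [modulated]
      refine (((𝓕 g : SchwartzMap (EV d) ℂ).integrable (μ := volume)).comp_sub_left ξ).bdd_mul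
        (c := 1) (continuous_ee.comp (by fun_prop)).aestronglyMeasurable ?_
      filter_upwards with x using (norm_ee _).le
    have e2 := EE_identity hFm hF1 G hG hC hCb hφ hψ
    have e3 : ∫ η, Fμ η * ∫ x, ee ⟪η, x⟫ * (ee (-⟪ξ, x⟫) * g (x - y)) =
        ee (-⟪ξ, y⟫) * UU Fμ (𝓕 g : SchwartzMap (EV d) ℂ) y ξ := by
      rw [UU, ← integral_const_mul]
      congr 1
      ext η
      rw [modulated, inner_sub_left, sub_eq_add_neg, ee_add]
      ring
    rw [e1, e2, e3, ← enorm_eq_nnnorm, enorm_mul]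
    rw [← ofReal_norm (ee _), norm_ee, ENNReal.ofReal_one, one_mul]

end

end Fresnel

/-- Under hypotheses (H), there exists a unique bounded continuous function
`E_μ` which is the inverse Fourier transform of the generalized Fresnel function `F_μ` in the
sense of tempered distributions, and `E_μ` belongs to the Wiener amalgam space `W^{1,∞}(ℝ^d)`:
`sup_y ‖g(·−y) E_μ‖_{FL¹} < ∞` for every Schwartz `g`. -/
theorem fresnel_inverse_fourier_W1inf (d : ℕ) (hd : 1 ≤ d) (m : ℝ) (hm : 2 ≤ m)
    (μ : EuclideanSpace ℝ (Fin d) → ℝ)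
    (hsmooth : ContDiffOn ℝ (⊤ : ℕ∞) μ {x | x ≠ 0})
    (hhom : ∀ c : ℝ, 0 < c → ∀ x : EuclideanSpace ℝ (Fin d), x ≠ 0 →
      μ (c • x) = c ^ m * μ x)
    (hhess : ∀ x : EuclideanSpace ℝ (Fin d), ‖x‖ = 1 →
      Function.Bijective ⇑(fderiv ℝ (fderiv ℝ μ) x))
    (Fμ : EuclideanSpace ℝ (Fin d) → ℂ)
    (hFμ : ∀ y : EuclideanSpace ℝ (Fin d), y ≠ 0 →
      Fμ y = Complex.exp (((2 * Real.pi * μ y : ℝ) : ℂ) * Complex.I))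
    (hFμ0 : Fμ 0 = 1) :
    ∃ Eμ : EuclideanSpace ℝ (Fin d) → ℂ,
      (Continuous Eμ ∧ (∃ M : ℝ, ∀ x, ‖Eμ x‖ ≤ M) ∧
        ∀ φ : SchwartzMap (EuclideanSpace ℝ (Fin d)) ℂ,
          ∫ x, Eμ x * φ x =
            ∫ ξ, Fμ ξ *
              ∫ x, Complex.exp (((2 * Real.pi * ⟪ξ, x⟫ : ℝ) : ℂ) * Complex.I) * φ x) ∧
      (∀ Eμ' : EuclideanSpace ℝ (Fin d) → ℂ,
        Continuous Eμ' → (∃ M : ℝ, ∀ x, ‖Eμ' x‖ ≤ M) →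
        (∀ φ : SchwartzMap (EuclideanSpace ℝ (Fin d)) ℂ,
          ∫ x, Eμ' x * φ x =
            ∫ ξ, Fμ ξ *
              ∫ x, Complex.exp (((2 * Real.pi * ⟪ξ, x⟫ : ℝ) : ℂ) * Complex.I) * φ x) →
        Eμ' = Eμ) ∧
      (∀ g : SchwartzMap (EuclideanSpace ℝ (Fin d)) ℂ,
        (⨆ y : EuclideanSpace ℝ (Fin d),
          ∫⁻ ξ : EuclideanSpace ℝ (Fin d),
            (‖∫ (x : EuclideanSpace ℝ (Fin d)),
                Complex.exp (-(((2 * Real.pi * ⟪ξ, x⟫ : ℝ) : ℂ) * Complex.I)) *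
                  g (x - y) * Eμ x‖₊ : ℝ≥0∞) ∂volume) < ⊤) := by
  exact Fresnel.main_result d hd m hm μ hsmooth hhom hhess Fμ hFμ hFμ0
end
end
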